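/- arXiv:1001.0377 — 3 statements merged into one kernel-verified Lean document; each statement's English description precedes it below -/
import Mathlib

section
/- Let p > 2, q > 1, T > 0, n ∈ ℕ (n ≥ 1), τ ∈ [0,T), and let τ_1, …, τ_n ≥ 0 with τ_1 + ⋯ + τ_n = τ. Set Λ_n(τ) = (2q/p*)·(nπ_{p/2,q}/(T−τ))^p, T_0 = 0 and T_j = (T−τ)j/n + Σ_{i=1}^j τ_i for j = 1, …, n, and define u : [0,T] → ℝ piecewise by: u(t) = (−1)^{j−1}·sin_{p/2,q}(nπ_{p/2,q}(t−T_{j−1})/(T−τ)) for T_{j−1} ≤ t ≤ T_{j−1} + (T−τ)/(2n); u(t) = (−1)^{j−1} for T_{j−1} + (T−τ)/(2n) ≤ t ≤ T_j − (T−τ)/(2n); and u(t) = (−1)^{j−1}·sin_{p/2,q}(nπ_{p/2,q}(T_j−t)/(T−τ)) for T_j − (T−τ)/(2n) ≤ t ≤ T_j (j = 1, …, n). Then u and −u are nontrivial classical solutions of (φ_p(u'))' + Λ_n(τ)·φ_q(u)·(1−|u|^q) = 0 on (0,T) with u(0) = u(T) = 0, satisfying |u| ≤ 1 with |u| attaining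 the value 1 on n flat intervals. -/
open Real Set Filter MeasureTheory

/-- Generalized arcsine: `arcsin_{pq}(σ) = ∫_0^σ (1 - s^q)^(-1/p) ds`. -/
noncomputable def arcsinPQ (p q σ : ℝ) : ℝ :=
  ∫ s in (0:ℝ)..σ, (1 - s ^ q) ^ (-(1 / p))

/-- The generalized half-period `π_{pq} = 2 arcsin_{pq}(1)`. -/
noncomputable def piPQ (p q : ℝ) : ℝ := 2 * arcsinPQ p q 1

/-- Generalized incomplete elliptic integral:
`arcsn_{pq}(σ,k) = ∫_0^σ ((1-s^q)(1-k^q s^q))^(-1/p) ds`. -/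
noncomputable def arcsnPQ (p q k σ : ℝ) : ℝ :=
  ∫ s in (0:ℝ)..σ, ((1 - s ^ q) * (1 - k ^ q * s ^ q)) ^ (-(1 / p))

/-- Generalized complete elliptic integral `K_{pq}(k) = arcsn_{pq}(1,k)`. -/
noncomputable def Kpq (p q k : ℝ) : ℝ := arcsnPQ p q k 1

/-- `φ_m(s) = |s|^(m-2) s` for `s ≠ 0`, `φ_m(0) = 0`. -/
noncomputable def phi (m s : ℝ) : ℝ := if s = 0 then 0 else |s| ^ (m - 2) * s

/-- Incomplete beta function `B̃(a,b,u) = ∫_0^u z^(a-1) (1-z)^(b-1) dz`. -/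
noncomputable def incBeta (a b u : ℝ) : ℝ :=
  ∫ z in (0:ℝ)..u, z ^ (a - 1) * (1 - z) ^ (b - 1)

/-- A classical solution of `(φ_p(u'))' + λ φ_q(u) = 0` on `(0,T)` with
`u(0) = u(T) = 0`: `u ∈ C¹([0,T])`, `t ↦ φ_p(u'(t))` is differentiable on `(0,T)`
and the equation holds at every point of `(0,T)`. -/
def IsSolE (p q T lam : ℝ) (u : ℝ → ℝ) : Prop :=
  ∃ u' : ℝ → ℝ,
    (∀ t ∈ Set.Icc 0 T, HasDerivWithinAt u (u' t) (Set.Icc 0 T) t) ∧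
    ContinuousOn u' (Set.Icc 0 T) ∧
    (∀ t ∈ Set.Ioo 0 T, HasDerivWithinAt (fun s => phi p (u' s))
      (-(lam * phi q (u t))) (Set.Ioo 0 T) t) ∧
    u 0 = 0 ∧ u T = 0

/-- A classical solution of `(φ_p(u'))' + λ φ_q(u)(1 - |u|^q) = 0` on `(0,T)` with
`u(0) = u(T) = 0`. -/
def IsSolP (p q T lam : ℝ) (u : ℝ → ℝ) : Prop :=
  ∃ u' : ℝ → ℝ,
    (∀ t ∈ Set.Icc 0 T, HasDerivWithinAt u (u' t) (Set.Icc 0 T) t) ∧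
    ContinuousOn u' (Set.Icc 0 T) ∧
    (∀ t ∈ Set.Ioo 0 T, HasDerivWithinAt (fun s => phi p (u' s))
      (-(lam * phi q (u t) * (1 - |u t| ^ q))) (Set.Ioo 0 T) t) ∧
    u 0 = 0 ∧ u T = 0

/-- `Φ(k) = (1+k^q)^(1/p) (2k^q/(1+k^q))^(1/q - 1/p) K_{pq}(k)`. -/
noncomputable def PhiFun (p q k : ℝ) : ℝ :=
  (1 + k ^ q) ^ (1 / p) * (2 * k ^ q / (1 + k ^ q)) ^ (1 / q - 1 / p) * Kpq p q k

lemma one_sub_le_one_sub_abs_rpow {q s : ℝ} (hq : 1 < q) (h1 : |s| ≤ 1) :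
    1 - |s| ≤ 1 - |s| ^ q := by
  have := Real.rpow_le_rpow_of_exponent_ge' (abs_nonneg s) h1 zero_le_one hq.le
  rw [Real.rpow_one] at this
  linarith

lemma one_sub_abs_rpow_nonneg {q s : ℝ} (hq : 1 < q) (h1 : |s| ≤ 1) : 0 ≤ 1 - |s| ^ q :=
  (sub_nonneg.2 h1).trans (one_sub_le_one_sub_abs_rpow hq h1)

lemma one_sub_abs_rpow_pos {q s : ℝ} (hq : 1 < q) (h1 : |s| < 1) : 0 < 1 - |s| ^ q :=
  (sub_pos.2 h1).trans_le (one_sub_le_one_sub_abs_rpow hq h1.le)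

/-- The even extension of the integrand of `arcsinPQ r q`. -/
noncomputable def arcsinIntegrand (r q s : ℝ) : ℝ := (1 - |s| ^ q) ^ (-(1 / r))

/-- The odd extension of `arcsinPQ r q`. -/
noncomputable def arcsinOdd (r q σ : ℝ) : ℝ := ∫ s in (0:ℝ)..σ, arcsinIntegrand r q s

lemma measurable_arcsinIntegrand (r q : ℝ) : Measurable (arcsinIntegrand r q) := by
  unfold arcsinIntegrand
  fun_prop

lemma intervalIntegrable_arcsinIntegrand {r q : ℝ} (hr : 1 < r) (hq : 1 < q) :
    IntervalIntegrable (arcsinIntegrand r q) volume (-1) 1 := by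
  have hr0 : 0 < r := by linarith
  have hexp : -1 < -(1 / r) := by
    have : 1 / r < 1 := by rw [div_lt_one hr0]; exact hr
    linarith
  have hpos : IntervalIntegrable (arcsinIntegrand r q) volume 0 1 := by
    have hbase : IntervalIntegrable (fun s : ℝ => (1 - s) ^ (-(1 / r))) volume 0 1 := by
      have h := (intervalIntegral.intervalIntegrable_rpow' (a := 1) (b := 0) hexp).comp_sub_left 1
      simpa using h
    refine hbase.mono_fun' (measurable_arcsinIntegrand r q).aestronglyMeasurable ?_
    have hne : ∀ᵐ s : ℝ, s ≠ 1 := by simp [ae_iff, measure_singleton]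
    refine (ae_restrict_iff' measurableSet_uIoc).2 (hne.mono fun s hs1 hs => ?_)
    rw [uIoc_of_le zero_le_one] at hs
    have hlt : s < 1 := lt_of_le_of_ne hs.2 hs1
    have habs : |s| = s := abs_of_pos hs.1
    have hle : 1 - s ≤ 1 - |s| ^ q := by
      simpa [habs] using one_sub_le_one_sub_abs_rpow (s := s) hq (by rw [habs]; exact hs.2)
    have hs' : 0 < 1 - s := by linarith
    unfold arcsinIntegrand
    beta_reduce
    rw [Real.norm_of_nonneg (Real.rpow_nonneg (hs'.le.trans hle) _)]
    exact Real.rpow_le_rpow_of_nonpos hs' hle (by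
      have : 0 < 1 / r := by positivity
      linarith)
  have hneg : IntervalIntegrable (arcsinIntegrand r q) volume (-1) 0 := by
    have h := ((IntervalIntegrable.iff_comp_neg).1 hpos).symm
    unfold arcsinIntegrand at h ⊢
    simpa using h
  exact hneg.trans hpos

lemma intervalIntegrable_arcsinIntegrand_of_mem {r q a b : ℝ} (hr : 1 < r) (hq : 1 < q)
    (ha : a ∈ Icc (-1 : ℝ) 1) (hb : b ∈ Icc (-1 : ℝ) 1) :
    IntervalIntegrable (arcsinIntegrand r q) volume a b := by
  refine (intervalIntegrable_arcsinIntegrand hr hq).mono_set ?_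
  rw [uIcc_of_le (by norm_num : (-1 : ℝ) ≤ 1)]
  exact (convex_Icc (-1 : ℝ) 1).ordConnected.uIcc_subset ha hb

lemma sub_le_arcsinOdd_sub {r q a b : ℝ} (hr : 1 < r) (hq : 1 < q)
    (ha : a ∈ Icc (-1 : ℝ) 1) (hb : b ∈ Icc (-1 : ℝ) 1) (hab : a ≤ b) :
    b - a ≤ arcsinOdd r q b - arcsinOdd r q a := by
  have h0 : (0 : ℝ) ∈ Icc (-1 : ℝ) 1 := by simp
  have hdiff : arcsinOdd r q b - arcsinOdd r q a = ∫ s in a..b, arcsinIntegrand r q s :=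
    intervalIntegral.integral_interval_sub_left
      (intervalIntegrable_arcsinIntegrand_of_mem hr hq h0 hb)
      (intervalIntegrable_arcsinIntegrand_of_mem hr hq h0 ha)
  have hone : b - a = ∫ _ in a..b, (1 : ℝ) := by simp
  rw [hdiff, hone]
  refine intervalIntegral.integral_mono_on_of_le_Ioo hab (by simp)
    (intervalIntegrable_arcsinIntegrand_of_mem hr hq ha hb) fun s hs => ?_
  have hs1 : |s| < 1 := abs_lt.2 ⟨ha.1.trans_lt hs.1, hs.2.trans_le hb.2⟩
  refine Real.one_le_rpow_of_pos_of_le_one_of_nonpos (one_sub_abs_rpow_pos hq hs1) ?_ ?_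
  · have := Real.rpow_nonneg (abs_nonneg s) q
    linarith
  · have : 0 < 1 / r := by positivity
    linarith

lemma arcsinOdd_neg (r q σ : ℝ) : arcsinOdd r q (-σ) = -arcsinOdd r q σ := by
  have h := intervalIntegral.integral_comp_neg (a := 0) (b := σ) (arcsinIntegrand r q)
  rw [arcsinOdd, arcsinOdd, intervalIntegral.integral_symm, ← neg_zero (G := ℝ), ← h]
  simp [arcsinIntegrand]

lemma arcsinOdd_eq_arcsinPQ {r q σ : ℝ} (h : 0 ≤ σ) : arcsinOdd r q σ = arcsinPQ r q σ := by
  refine intervalIntegral.integral_congr fun s hs => ?_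
  rw [uIcc_of_le h] at hs
  simp [arcsinIntegrand, abs_of_nonneg hs.1]

lemma continuousOn_arcsinOdd {r q : ℝ} (hr : 1 < r) (hq : 1 < q) :
    ContinuousOn (arcsinOdd r q) (Icc (-1) 1) := by
  have h := intervalIntegral.continuousOn_primitive_interval'
    (intervalIntegrable_arcsinIntegrand hr hq) (a := 0) (by simp)
  rwa [uIcc_of_le (by norm_num : (-1 : ℝ) ≤ 1)] at h

lemma hasDerivAt_arcsinOdd {r q σ : ℝ} (hr : 1 < r) (hq : 1 < q) (h : |σ| < 1) :
    HasDerivAt (arcsinOdd r q) (arcsinIntegrand r q σ) σ := by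
  refine intervalIntegral.integral_hasDerivAt_right
    (intervalIntegrable_arcsinIntegrand_of_mem hr hq (by simp) (abs_le.1 h.le))
    (measurable_arcsinIntegrand r q).stronglyMeasurable.stronglyMeasurableAtFilter ?_
  refine ContinuousAt.rpow_const ?_ (Or.inl (one_sub_abs_rpow_pos hq h).ne')
  exact continuousAt_const.sub
    (continuous_abs.continuousAt.rpow_const (Or.inr (by linarith)))

lemma hasDerivAt_of_hasDerivAt_off_countable {f g : ℝ → ℝ} {s : Set ℝ} (hs : s.Countable)
    (hf : Continuous f) (hg : Continuous g) (h : ∀ x ∉ s, HasDerivAt f (g x) x) (x : ℝ) :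
    HasDerivAt f (g x) x := by
  have hint : ∀ y, f y = f 0 + ∫ t in (0:ℝ)..y, g t := fun y => by
    rw [MeasureTheory.integral_eq_of_hasDerivAt_off_countable f g hs hf.continuousOn
      (fun z hz => h z hz.2) (hg.intervalIntegrable _ _)]
    ring
  rw [funext hint]
  exact (intervalIntegral.integral_hasDerivAt_right (hg.intervalIntegrable _ _)
    hg.stronglyMeasurable.stronglyMeasurableAtFilter hg.continuousAt).const_add _

lemma arcsinPQ_one_pos {r q : ℝ} (hr : 1 < r) (hq : 1 < q) : 0 < arcsinPQ r q 1 := by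
  have h := sub_le_arcsinOdd_sub hr hq (a := 0) (b := 1) (by simp) (by simp) zero_le_one
  have h0 : arcsinOdd r q 0 = 0 := by simp [arcsinOdd]
  rw [h0, arcsinOdd_eq_arcsinPQ zero_le_one] at h
  linarith

/-- The generalized sine, continued by the constants `±1` beyond its first extrema, is a global
solution of `G' = (1 - |G|^q)^(1/r)`. -/
lemma exists_clamped_sine {r q : ℝ} (hr : 1 < r) (hq : 1 < q) {S : ℝ → ℝ}
    (hinv : ∀ σ ∈ Icc (0:ℝ) 1, S (arcsinPQ r q σ) = σ) (hodd : ∀ t, S (-t) = -S t) :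
    ∃ G : ℝ → ℝ, (∀ x, HasDerivAt G ((1 - |G x| ^ q) ^ (1 / r)) x) ∧ (∀ x, |G x| ≤ 1) ∧
      (∀ x, arcsinPQ r q 1 ≤ x → G x = 1) ∧ (∀ x, x ≤ -arcsinPQ r q 1 → G x = -1) ∧
      ∀ x, |x| ≤ arcsinPQ r q 1 → G x = S x := by
  set a := arcsinPQ r q 1 with ha
  have hapos : 0 < a := arcsinPQ_one_pos hr hq
  have hF1 : arcsinOdd r q 1 = a := arcsinOdd_eq_arcsinPQ zero_le_one
  have hSF : ∀ σ ∈ Icc (-1:ℝ) 1, S (arcsinOdd r q σ) = σ := by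
    intro σ hσ
    rcases le_total 0 σ with h | h
    · rw [arcsinOdd_eq_arcsinPQ h, hinv σ ⟨h, hσ.2⟩]
    · have h' : 0 ≤ -σ := by linarith
      have := hinv (-σ) ⟨h', by linarith [hσ.1]⟩
      rw [← arcsinOdd_eq_arcsinPQ h', arcsinOdd_neg, hodd] at this
      linarith
  have hsurj : ∀ x, |x| ≤ a → ∃ σ ∈ Icc (-1:ℝ) 1, arcsinOdd r q σ = x := by
    intro x hx
    have h := intermediate_value_Icc (by norm_num : (-1:ℝ) ≤ 1) (continuousOn_arcsinOdd hr hq)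
    rw [arcsinOdd_neg, hF1] at h
    obtain ⟨σ, h1, h2⟩ := h (abs_le.1 hx)
    exact ⟨σ, h1, h2⟩
  have hS1 : S a = 1 := by rw [ha]; exact hinv 1 (by simp)
  have hSm1 : S (-a) = -1 := by rw [hodd, hS1]
  let c : ℝ → ℝ := fun x => max (-a) (min a x)
  have hc : ∀ x, |c x| ≤ a := fun x =>
    abs_le.2 ⟨le_max_left _ _, max_le (by linarith) (min_le_left _ _)⟩
  have hceq : ∀ x, |x| ≤ a → c x = x := fun x hx => by
    have := abs_le.1 hx
    simp only [c]
    rw [min_eq_right this.2, max_eq_right this.1]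
  have hSlip : ∀ x y, |x| ≤ a → |y| ≤ a → |S x - S y| ≤ |x - y| := by
    intro x y hx hy
    obtain ⟨σ, hσ, rfl⟩ := hsurj x hx
    obtain ⟨ρ, hρ, rfl⟩ := hsurj y hy
    rw [hSF σ hσ, hSF ρ hρ]
    rcases le_total σ ρ with h | h
    · have := sub_le_arcsinOdd_sub hr hq hσ hρ h
      rw [abs_sub_comm, abs_of_nonneg (by linarith), abs_sub_comm]
      exact this.trans (le_abs_self _)
    · have := sub_le_arcsinOdd_sub hr hq hρ hσ h
      rw [abs_of_nonneg (by linarith)]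
      exact this.trans (le_abs_self _)
  have hScont : ContinuousOn S (Icc (-a) a) := by
    refine LipschitzOnWith.continuousOn (K := 1) (LipschitzOnWith.of_dist_le_mul ?_)
    intro x hx y hy
    simpa [Real.dist_eq] using hSlip x y (abs_le.2 hx) (abs_le.2 hy)
  have hccont : Continuous c := by fun_prop
  have hGcont : Continuous fun x => S (c x) :=
    hScont.comp_continuous hccont fun x => abs_le.1 (hc x)
  have hG1 : ∀ x, a ≤ x → S (c x) = 1 := fun x hx => by
    have : c x = a := by
      simp only [c]
      rw [min_eq_left hx, max_eq_right (by linarith)]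
    rw [this, hS1]
  have hGm1 : ∀ x, x ≤ -a → S (c x) = -1 := fun x hx => by
    have : c x = -a := by
      simp only [c]
      rw [min_eq_right (by linarith), max_eq_left hx]
    rw [this, hSm1]
  have hGle : ∀ x, |S (c x)| ≤ 1 := fun x => by
    obtain ⟨σ, hσ, h⟩ := hsurj (c x) (hc x)
    rw [← h, hSF σ hσ]
    exact abs_le.2 hσ
  have hr0 : 0 < 1 / r := by positivity
  refine ⟨fun x => S (c x), ?_, hGle, hG1, hGm1, fun x hx => by simp only [hceq x hx]⟩
  refine hasDerivAt_of_hasDerivAt_off_countable (s := {a, -a}) (by simp) hGcont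
    (g := fun x => (1 - |S (c x)| ^ q) ^ (1 / r)) ?_ fun x hx => ?_
  · exact (continuous_const.sub (hGcont.abs.rpow_const fun _ => Or.inr (by linarith))).rpow_const
      fun _ => Or.inr hr0.le
  simp only [mem_insert_iff, mem_singleton_iff, not_or] at hx
  rcases lt_or_gt_of_ne hx.1 with hxa | hxa
  · rcases lt_or_gt_of_ne hx.2 with hxb | hxb
    · have hev : (fun x => S (c x)) =ᶠ[nhds x] fun _ => -1 := by
        filter_upwards [Iio_mem_nhds hxb] with y hy using hGm1 y (le_of_lt hy)
      rw [hGm1 x hxb.le]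
      simpa [Real.zero_rpow (inv_pos.2 (by linarith : 0 < r)).ne'] using
        (hasDerivAt_const x (-1:ℝ)).congr_of_eventuallyEq hev
    · obtain ⟨σ, hσ, hFσ⟩ := hsurj x (abs_le.2 ⟨hxb.le, hxa.le⟩)
      have hGx : S (c x) = σ := by
        rw [hceq x (abs_le.2 ⟨hxb.le, hxa.le⟩), ← hFσ, hSF σ hσ]
      have hσ1 : |σ| < 1 := by
        refine lt_of_le_of_ne (abs_le.2 hσ) fun h => ?_
        rcases eq_or_eq_neg_of_abs_eq h with h | h
        · rw [h, hF1] at hFσ; linarith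
        · rw [h, arcsinOdd_neg, hF1] at hFσ; linarith
      have hpos := one_sub_abs_rpow_pos hq hσ1
      have hd := hasDerivAt_arcsinOdd hr hq hσ1
      have hne : arcsinIntegrand r q σ ≠ 0 := (Real.rpow_pos_of_pos hpos _).ne'
      have key := HasDerivAt.of_local_left_inverse (g := fun x => S (c x)) (a := x)
        hGcont.continuousAt (by simpa only [hGx] using hd) hne (by
          filter_upwards [Ioo_mem_nhds hxb hxa] with y hy
          have hy' : |y| ≤ a := abs_le.2 ⟨hy.1.le, hy.2.le⟩
          obtain ⟨ρ, hρ, h⟩ := hsurj y hy'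
          rw [hceq y hy', ← h, hSF ρ hρ])
      rw [arcsinIntegrand, ← Real.rpow_neg hpos.le, neg_neg] at key
      rwa [hGx]
  · have hev : (fun x => S (c x)) =ᶠ[nhds x] fun _ => 1 := by
      filter_upwards [Ioi_mem_nhds hxa] with y hy using hG1 y (le_of_lt hy)
    rw [hG1 x (le_of_lt hxa)]
    simpa [Real.zero_rpow (inv_pos.2 (by linarith : 0 < r)).ne'] using
      (hasDerivAt_const x (1:ℝ)).congr_of_eventuallyEq hev

lemma phi_neg (m s : ℝ) : phi m (-s) = -phi m s := by
  unfold phi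
  split_ifs <;> simp_all

lemma phi_of_pos {m s : ℝ} (hs : 0 < s) : phi m s = s ^ (m - 1) := by
  rw [phi, if_neg hs.ne', abs_of_pos hs, ← Real.rpow_add_one hs.ne']
  congr 1
  ring

lemma phi_of_nonneg {m s : ℝ} (hm : 1 < m) (hs : 0 ≤ s) : phi m s = s ^ (m - 1) := by
  rcases hs.eq_or_lt with rfl | hs
  · rw [phi, if_pos rfl, Real.zero_rpow (by linarith)]
  · exact phi_of_pos hs

lemma phi_neg_one_pow_mul (m s : ℝ) (j : ℕ) : phi m ((-1) ^ j * s) = (-1) ^ j * phi m s := by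
  rcases neg_one_pow_eq_or ℝ j with h | h <;> simp [h, phi_neg]

lemma phi_eq_abs_rpow_mul (m s : ℝ) : phi m s = |s| ^ (m - 2) * s := by
  by_cases h : s = 0 <;> simp [phi, h]

lemma IsSolP.neg {p q T lam : ℝ} {u : ℝ → ℝ} (h : IsSolP p q T lam u) :
    IsSolP p q T lam fun t => -u t := by
  obtain ⟨u', hd, hc, he, h0, hT⟩ := h
  refine ⟨fun t => -u' t, fun t ht => (hd t ht).neg, hc.neg, fun t ht => ?_, by simp [h0],
    by simp [hT]⟩
  simp only [phi_neg, abs_neg]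
  exact (he t ht).fun_neg.congr_deriv (by ring)

lemma hasDerivAt_one_sub_abs_rpow_rpow {p q x : ℝ} {G : ℝ → ℝ} (hp : 2 < p) (hq : 1 < q)
    (hG : HasDerivAt G ((1 - |G x| ^ q) ^ (1 / (p / 2))) x) (hG1 : |G x| ≤ 1) :
    HasDerivAt (fun y => (1 - |G y| ^ q) ^ (1 / (p / 2) * (p - 1)))
      (-(2 * q / (p / (p - 1)) * phi q (G x) * (1 - |G x| ^ q))) x := by
  have hp0 : 0 < p := by linarith
  have he : 1 ≤ 1 / (p / 2) * (p - 1) := by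
    have : 1 / (p / 2) * (p - 1) = (2 * p - 2) / p := by field_simp
    rw [this, le_div_iff₀ hp0]
    linarith
  have h1 : HasDerivAt (fun y => 1 - |G y| ^ q) _ x :=
    ((hasDerivAt_abs_rpow (G x) hq).comp x hG).const_sub 1
  have h2 := h1.rpow_const (p := 1 / (p / 2) * (p - 1)) (Or.inr he)
  convert h2 using 1
  have hnn := one_sub_abs_rpow_nonneg hq hG1
  have hsum : 1 / (p / 2) + (1 / (p / 2) * (p - 1) - 1) = 1 := by
    field_simp
    ring
  have hmul : 1 - |G x| ^ q = (1 - |G x| ^ q) ^ (1 / (p / 2)) *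
      (1 - |G x| ^ q) ^ (1 / (p / 2) * (p - 1) - 1) := by
    rw [← Real.rpow_add' hnn (by rw [hsum]; exact one_ne_zero), hsum, Real.rpow_one]
  have hcoef : 2 * q / (p / (p - 1)) = q * (1 / (p / 2) * (p - 1)) := by
    field_simp
  rw [hcoef, phi_eq_abs_rpow_mul]
  generalize (1 - |G x| ^ q) ^ (1 / (p / 2)) = A at hmul ⊢
  generalize (1 - |G x| ^ q) ^ (1 / (p / 2) * (p - 1) - 1) = B at hmul ⊢
  rw [hmul]
  ring

lemma sum_range_neg_one_pow_mul_two (j : ℕ) :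
    ∑ i ∈ Finset.range j, (-1 : ℝ) ^ i * 2 = 1 - (-1) ^ j := by
  induction j with
  | zero => simp
  | succ k ih => rw [Finset.sum_range_succ, ih, pow_succ]; ring

/-- Glueing translates of a clamped sine with alternating signs yields a solution, provided that at
each time all the translates but one are constant. -/
lemma isSolP_of_glued {p q T a ω h : ℝ} (hp : 2 < p) (hq : 1 < q) (hω : 0 < ω)
    (hωh : ω * h = a) {n : ℕ} {c : ℕ → ℝ} {G u : ℝ → ℝ}
    (hG : ∀ x, HasDerivAt G ((1 - |G x| ^ q) ^ (1 / (p / 2))) x) (hG1 : ∀ x, |G x| ≤ 1)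
    (hGr : ∀ x, a ≤ x → G x = 1) (hGl : ∀ x, x ≤ -a → G x = -1)
    (hu : ∀ t ∈ Icc 0 T, ∃ j ≤ n, (∀ i < j, c i + h ≤ t) ∧
      (∀ i, j < i → i ≤ n → t ≤ c i - h) ∧ u t = (-1) ^ j * G (ω * (t - c j)))
    (hu0 : u 0 = 0) (huT : u T = 0) :
    IsSolP p q T (2 * q / (p / (p - 1)) * ω ^ p) u := by
  have hp0 : 0 < p := by linarith
  have hr0 : 0 < 1 / (p / 2) := by positivity
  have hsel : ∀ t ∈ Icc 0 T, ∃ j ≤ n, (∀ i < j, G (ω * (t - c i)) = 1) ∧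
      (∀ i, j < i → i ≤ n → G (ω * (t - c i)) = -1) ∧
      u t = (-1) ^ j * G (ω * (t - c j)) := by
    intro t ht
    obtain ⟨j, hj, hl, hr, huj⟩ := hu t ht
    refine ⟨j, hj, fun i hi => hGr _ ?_, fun i hi hin => hGl _ ?_, huj⟩
    · rw [← hωh]
      exact mul_le_mul_of_nonneg_left (by linarith [hl i hi]) hω.le
    · rw [← hωh, ← mul_neg]
      exact mul_le_mul_of_nonneg_left (by linarith [hr i hi hin]) hω.le
  have hGc : Continuous G := continuous_iff_continuousAt.2 fun x => (hG x).continuousAt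
  have hlin : ∀ i t, HasDerivAt (fun t => ω * (t - c i)) ω t := fun i t => by
    simpa using ((hasDerivAt_id t).sub_const (c i)).const_mul ω
  let g : ℝ → ℝ := fun x => (1 - |G x| ^ q) ^ (1 / (p / 2))
  have hg : Continuous g :=
    (continuous_const.sub (hGc.abs.rpow_const fun _ => Or.inr (by linarith))).rpow_const
      fun _ => Or.inr hr0.le
  have hg0 : ∀ x, |G x| = 1 → g x = 0 := fun x hx => by
    simp only [g, hx, Real.one_rpow, sub_self]
    exact Real.zero_rpow hr0.ne'
  have hsingle : ∀ (F : ℝ → ℝ) (t : ℝ) (j : ℕ), j ≤ n → (∀ x, |G x| = 1 → F x = 0) →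
      (∀ i < j, G (ω * (t - c i)) = 1) → (∀ i, j < i → i ≤ n → G (ω * (t - c i)) = -1) →
      ∑ i ∈ Finset.range (n + 1), (-1 : ℝ) ^ i * F (ω * (t - c i)) =
        (-1) ^ j * F (ω * (t - c j)) := by
    intro F t j hj hF hl hr
    refine Finset.sum_eq_single j (fun i hi hij => ?_) fun hj' => ?_
    · rcases lt_or_gt_of_ne hij with h | h
      · rw [hF _ (by rw [hl i h, abs_one]), mul_zero]
      · rw [hF _ (by rw [hr i h (Nat.lt_succ_iff.1 (Finset.mem_range.1 hi)), abs_neg, abs_one]),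
          mul_zero]
    · exact absurd (Finset.mem_range.2 (Nat.lt_succ_of_le hj)) hj'
  have huP : ∀ t ∈ Icc 0 T,
      u t = ∑ i ∈ Finset.range (n + 1), (-1 : ℝ) ^ i * (G (ω * (t - c i)) + 1) - 1 := by
    intro t ht
    obtain ⟨j, hj, hl, hr, huj⟩ := hsel t ht
    have hsub : Finset.range (j + 1) ⊆ Finset.range (n + 1) :=
      Finset.range_subset_range.2 (by omega)
    rw [← Finset.sum_subset hsub fun i hi hi' => ?_, Finset.sum_range_succ,
      Finset.sum_congr rfl (g := fun i => (-1 : ℝ) ^ i * 2) fun i hi => ?_,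
      sum_range_neg_one_pow_mul_two, huj]
    · ring
    · rw [hl i (Finset.mem_range.1 hi)]; norm_num
    · simp only [Finset.mem_range] at hi hi'
      rw [hr i (by omega) (by omega)]; norm_num
  refine ⟨fun t => ∑ i ∈ Finset.range (n + 1), (-1 : ℝ) ^ i * (g (ω * (t - c i)) * ω),
    fun t ht => ?_, ?_, fun t ht => ?_, hu0, huT⟩
  · have hd : HasDerivAt
        (fun t => ∑ i ∈ Finset.range (n + 1), (-1 : ℝ) ^ i * (G (ω * (t - c i)) + 1) - 1)
        (∑ i ∈ Finset.range (n + 1), (-1 : ℝ) ^ i * (g (ω * (t - c i)) * ω)) t :=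
      (HasDerivAt.fun_sum fun i _ => ((((hG _).comp t (hlin i t)).add_const 1).const_mul _)).sub_const 1
    exact hd.hasDerivWithinAt.congr huP (huP t ht)
  · fun_prop
  · let M : ℝ → ℝ := fun x => (1 - |G x| ^ q) ^ (1 / (p / 2) * (p - 1))
    let N : ℝ → ℝ := fun x => -(2 * q / (p / (p - 1)) * phi q (G x) * (1 - |G x| ^ q))
    have hM : ∀ x, HasDerivAt M (N x) x := fun x =>
      hasDerivAt_one_sub_abs_rpow_rpow hp hq (hG x) (hG1 x)
    have hflux : ∀ s ∈ Icc 0 T,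
        phi p (∑ i ∈ Finset.range (n + 1), (-1 : ℝ) ^ i * (g (ω * (s - c i)) * ω)) =
          ∑ i ∈ Finset.range (n + 1), (-1 : ℝ) ^ i * (M (ω * (s - c i)) * ω ^ (p - 1)) := by
      intro s hs
      obtain ⟨j, hj, hl, hr, -⟩ := hsel s hs
      have hnn := one_sub_abs_rpow_nonneg hq (hG1 (ω * (s - c j)))
      have hgnn : 0 ≤ g (ω * (s - c j)) := Real.rpow_nonneg hnn _
      rw [hsingle (fun x => g x * ω) s j hj (fun x hx => by simp [hg0 x hx]) hl hr,
        hsingle (fun x => M x * ω ^ (p - 1)) s j hj (fun x hx => ?_) hl hr,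
        phi_neg_one_pow_mul, phi_of_nonneg (by linarith) (by positivity),
        Real.mul_rpow hgnn hω.le]
      · simp only [g, M]
        rw [Real.rpow_mul hnn]
      · simp only [M, hx, Real.one_rpow, sub_self]
        rw [Real.zero_rpow (mul_pos hr0 (by linarith)).ne', zero_mul]
    have hd : HasDerivAt
        (fun s => ∑ i ∈ Finset.range (n + 1), (-1 : ℝ) ^ i * (M (ω * (s - c i)) * ω ^ (p - 1)))
        (∑ i ∈ Finset.range (n + 1), (-1 : ℝ) ^ i * (N (ω * (t - c i)) * ω * ω ^ (p - 1))) t :=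
      HasDerivAt.fun_sum fun i _ =>
        ((((hM _).comp t (hlin i t)).mul_const (ω ^ (p - 1))).const_mul _)
    have ht' := Ioo_subset_Icc_self ht
    obtain ⟨j, hj, hl, hr, huj⟩ := hsel t ht'
    have hval : ∑ i ∈ Finset.range (n + 1), (-1 : ℝ) ^ i * (N (ω * (t - c i)) * ω * ω ^ (p - 1)) =
        -(2 * q / (p / (p - 1)) * ω ^ p * phi q (u t) * (1 - |u t| ^ q)) := by
      rw [hsingle (fun x => N x * ω * ω ^ (p - 1)) t j hj (fun x hx => by simp [N, hx]) hl hr, huj,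
        phi_neg_one_pow_mul, abs_mul, abs_pow, abs_neg, abs_one, one_pow, one_mul]
      have hωp : ω ^ p = ω * ω ^ (p - 1) := by
        rw [mul_comm, ← Real.rpow_add_one hω.ne', sub_add_cancel]
      rw [hωp]
      simp only [N]
      ring
    rw [← hval]
    exact hd.hasDerivWithinAt.congr (fun s hs => hflux s (Ioo_subset_Icc_self hs)) (hflux t ht')

theorem stmt15 (p q T : ℝ) (hp : 2 < p) (hq : 1 < q) (hT : 0 < T)
    (n : ℕ) (hn : 1 ≤ n) (τ : ℝ) (hτ : τ ∈ Ico 0 T)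
    (τs : ℕ → ℝ) (hτs : ∀ i, 1 ≤ i → i ≤ n → 0 ≤ τs i)
    (hsum : ∑ i ∈ Finset.Icc 1 n, τs i = τ)
    (sin2 : ℝ → ℝ)
    (hinv : ∀ σ ∈ Icc (0:ℝ) 1, sin2 (arcsinPQ (p / 2) q σ) = σ)
    (hrefl : ∀ t ∈ Icc (piPQ (p / 2) q / 2) (piPQ (p / 2) q),
      sin2 t = sin2 (piPQ (p / 2) q - t))
    (hodd : ∀ t : ℝ, sin2 (-t) = - sin2 t)
    (hper : ∀ t : ℝ, sin2 (t + 2 * piPQ (p / 2) q) = sin2 t)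
    (Tj : ℕ → ℝ)
    (hTj : ∀ j : ℕ, Tj j = (T - τ) * (j : ℝ) / (n : ℝ) + ∑ i ∈ Finset.Icc 1 j, τs i)
    (u : ℝ → ℝ)
    (hu1 : ∀ j : ℕ, 1 ≤ j → j ≤ n → ∀ t : ℝ,
      Tj (j - 1) ≤ t → t ≤ Tj (j - 1) + (T - τ) / (2 * (n : ℝ)) →
      u t = (-1 : ℝ) ^ (j - 1) *
        sin2 ((n : ℝ) * piPQ (p / 2) q * (t - Tj (j - 1)) / (T - τ)))
    (hu2 : ∀ j : ℕ, 1 ≤ j → j ≤ n → ∀ t : ℝ,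
      Tj (j - 1) + (T - τ) / (2 * (n : ℝ)) ≤ t → t ≤ Tj j - (T - τ) / (2 * (n : ℝ)) →
      u t = (-1 : ℝ) ^ (j - 1))
    (hu3 : ∀ j : ℕ, 1 ≤ j → j ≤ n → ∀ t : ℝ,
      Tj j - (T - τ) / (2 * (n : ℝ)) ≤ t → t ≤ Tj j →
      u t = (-1 : ℝ) ^ (j - 1) *
        sin2 ((n : ℝ) * piPQ (p / 2) q * (Tj j - t) / (T - τ))) :
    let Λ := 2 * q / (p / (p - 1)) * ((n : ℝ) * piPQ (p / 2) q / (T - τ)) ^ p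
    IsSolP p q T Λ u ∧ IsSolP p q T Λ (fun t => -u t) ∧
    (¬ ∀ t ∈ Icc (0:ℝ) T, u t = 0) ∧
    (∀ t ∈ Icc (0:ℝ) T, |u t| ≤ 1) ∧
    (∀ j : ℕ, 1 ≤ j → j ≤ n →
      ∀ t ∈ Icc (Tj (j - 1) + (T - τ) / (2 * (n : ℝ))) (Tj j - (T - τ) / (2 * (n : ℝ))),
        |u t| = 1) := by
  intro Λ
  obtain ⟨hτ0, hτT⟩ := hτ
  have hn0 : (0:ℝ) < n := by exact_mod_cast hn
  have hr : 1 < p / 2 := by linarith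
  set a := arcsinPQ (p / 2) q 1 with ha
  have hapos : 0 < a := arcsinPQ_one_pos hr hq
  have hpi : piPQ (p / 2) q = 2 * a := rfl
  set h := (T - τ) / (2 * (n : ℝ)) with hh
  have hd : 0 < T - τ := by linarith
  have hpos : 0 < h := by positivity
  set ω := (n : ℝ) * piPQ (p / 2) q / (T - τ) with hωdef
  have hω : 0 < ω := by rw [hωdef, hpi]; positivity
  have hωh : ω * h = a := by
    rw [hωdef, hh, hpi]
    field_simp
  have harg : ∀ x : ℝ, (n : ℝ) * piPQ (p / 2) q * x / (T - τ) = ω * x := fun x => by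
    rw [hωdef]; ring
  simp only [harg] at hu1 hu3
  obtain ⟨G, hG, hG1, hGr, hGl, hGS⟩ := exists_clamped_sine hr hq hinv hodd
  have hT0 : Tj 0 = 0 := by simp [hTj]
  have hTn : Tj n = T := by
    rw [hTj, hsum, mul_div_assoc, div_self hn0.ne']
    ring
  have hstep : ∀ j < n, Tj j + 2 * h ≤ Tj (j + 1) := by
    intro j hj
    have h1 := hτs (j + 1) (by omega) (by omega)
    rw [hTj, hTj, Finset.sum_Icc_succ_top (by omega), hh]
    have : (T - τ) * ((j + 1 : ℕ) : ℝ) / n = (T - τ) * j / n + 2 * ((T - τ) / (2 * n)) := by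
      push_cast
      field_simp
    linarith
  have hmono : ∀ i j, i < j → j ≤ n → Tj i + 2 * h ≤ Tj j := by
    intro i j hij
    induction j, hij using Nat.le_induction with
    | base => exact fun hj => hstep i hj
    | succ k hk ih => exact fun hj => by linarith [ih (by omega), hstep k hj]
  have hGω : ∀ x, |x| ≤ h → G (ω * x) = sin2 (ω * x) := fun x hx => by
    refine hGS _ ?_
    rw [abs_mul, abs_of_pos hω, ← ha, ← hωh]
    exact mul_le_mul_of_nonneg_left hx hω.le
  have hsel : ∀ t ∈ Icc 0 T, ∃ j ≤ n, (∀ i < j, Tj i + h ≤ t) ∧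
      (∀ i, j < i → i ≤ n → t ≤ Tj i - h) ∧ u t = (-1) ^ j * G (ω * (t - Tj j)) := by
    intro t ht
    classical
    let P : ℕ → Prop := fun j => Tj j - h ≤ t
    have hP0 : P 0 := by simp only [P, hT0]; linarith [ht.1]
    have hj : Nat.findGreatest P n ≤ n := Nat.findGreatest_le n
    have hPj : P (Nat.findGreatest P n) := Nat.findGreatest_spec (Nat.zero_le n) hP0
    have hPgt : ∀ i, Nat.findGreatest P n < i → i ≤ n → t < Tj i - h := fun i hi hin =>
      not_le.1 (Nat.findGreatest_is_greatest hi hin)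
    generalize Nat.findGreatest P n = j at hj hPj hPgt
    simp only [P] at hPj
    refine ⟨j, hj, fun i hi => by linarith [hmono i j hi hj], fun i hi hin => (hPgt i hi hin).le, ?_⟩
    have hleft : 1 ≤ j → t ≤ Tj j → u t = (-1) ^ j * G (ω * (t - Tj j)) := by
      intro hj1 htj
      rw [hu3 j hj1 hj t hPj htj, hGω _ (abs_le.2 ⟨by linarith, by linarith⟩)]
      obtain ⟨k, rfl⟩ : ∃ k, j = k + 1 := ⟨j - 1, by omega⟩
      rw [← neg_sub t, mul_neg, hodd, pow_succ, Nat.add_sub_cancel]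
      ring
    rcases hj.eq_or_lt with hjn | hjn
    · exact hleft (by omega) (by rw [hjn, hTn]; exact ht.2)
    rcases le_or_gt (Tj j) t with htj | htj
    · rcases le_total t (Tj j + h) with hth | hth
      · have := hu1 (j + 1) (by omega) (by omega) t (by simpa using htj) (by simpa using hth)
        rw [this, hGω _ (abs_le.2 ⟨by linarith, by linarith⟩), Nat.add_sub_cancel]
      · have := hu2 (j + 1) (by omega) (by omega) t (by simpa using hth)
          (hPgt (j + 1) (by omega) (by omega)).le
        rw [this, Nat.add_sub_cancel, hGr, mul_one]
        rw [← ha, ← hωh]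
        exact mul_le_mul_of_nonneg_left (by linarith) hω.le
    · refine hleft (Nat.one_le_iff_ne_zero.2 fun hj0 => ?_) htj.le
      rw [hj0, hT0] at htj
      linarith [ht.1]
  have hS0 : sin2 0 = 0 := by
    have := hodd 0
    rw [neg_zero] at this
    linarith
  have hu0 : u 0 = 0 := by
    rw [hu1 1 le_rfl hn 0 (by simp [hT0]) (by simpa [hT0] using hpos.le)]
    simp [hT0, hS0]
  have huT : u T = 0 := by
    rw [hu3 n hn le_rfl T (by rw [hTn]; linarith) hTn.ge, hTn, sub_self, mul_zero, hS0, mul_zero]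
  have hsol : IsSolP p q T Λ u := isSolP_of_glued hp hq hω hωh hG hG1 hGr hGl hsel hu0 huT
  have hflat : ∀ j : ℕ, 1 ≤ j → j ≤ n →
      ∀ t ∈ Icc (Tj (j - 1) + h) (Tj j - h), |u t| = 1 := fun j hj1 hjn t ht => by
    rw [hu2 j hj1 hjn t ht.1 ht.2, abs_pow, abs_neg, abs_one, one_pow]
  refine ⟨hsol, hsol.neg, fun hzero => ?_, fun t ht => ?_, hflat⟩
  · have hstep0 := hmono 0 1 one_pos hn
    have hlast : Tj 1 ≤ T := by
      rcases hn.eq_or_lt with h1 | h1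
      · rw [h1, hTn]
      · rw [← hTn]
        linarith [hmono 1 n h1 le_rfl]
    rw [hT0] at hstep0
    have h1 := hflat 1 le_rfl hn h ⟨by simp [hT0], by linarith⟩
    rw [hzero h ⟨hpos.le, by linarith⟩] at h1
    simp at h1
  · obtain ⟨j, -, -, -, huj⟩ := hsel t ht
    rw [huj, abs_mul, abs_pow, abs_neg, abs_one, one_pow, one_mul]
    exact hG1 _
end

section
/- Let p ≥ q > 1 and define Φ(k) = (1+k^q)^{1/p}·(2k^q/(1+k^q))^{1/q−1/p}·K_{pq}(k) for k ∈ (0,1). Then Φ is strictly increasing on (0,1); if p > q then Φ(k) → 0 as k → 0+, while if p = q then Φ(k) → π_{pq}/2 as k → 0+; and as k → 1−, Φ(k) → +∞ if p ≤ 2, while Φ(k) → 2^{1/p−1}·π_{p/2,q} if p > 2. -/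
open Real Set Filter MeasureTheory

/-- The radicand of the integrand of `Kpq` dominates its value at `q = 1`. -/
theorem kernel_lower {q k s : ℝ} (hq : 1 ≤ q) (hk0 : 0 ≤ k) (hk1 : k ≤ 1)
    (hs0 : 0 ≤ s) (hs1 : s ≤ 1) :
    (1 - s) * (1 - k * s) ≤ (1 - s ^ q) * (1 - k ^ q * s ^ q) := by
  have rpow_le {x : ℝ} (h0 : 0 ≤ x) (h1 : x ≤ 1) : x ^ q ≤ x := by
    simpa using Real.rpow_le_rpow_of_exponent_ge_of_imp h0 h1 hq (by intro _ h; linarith)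
  have hks1 : k * s ≤ 1 := mul_le_one₀ hk1 hs0 hs1
  rw [← Real.mul_rpow hk0 hs0]
  have h1 := rpow_le hs0 hs1
  have h2 := rpow_le (mul_nonneg hk0 hs0) hks1
  exact mul_le_mul (by linarith) (by linarith) (by linarith) (by linarith)

theorem kernel_pos {q k s : ℝ} (hq : 1 ≤ q) (hk0 : 0 ≤ k) (hk1 : k ≤ 1)
    (hs0 : 0 ≤ s) (hs1 : s < 1) : 0 < (1 - s ^ q) * (1 - k ^ q * s ^ q) := by
  refine lt_of_lt_of_le ?_ (kernel_lower hq hk0 hk1 hs0 hs1.le)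
  have : k * s ≤ s := mul_le_of_le_one_left hs0 hk1
  exact mul_pos (by linarith) (by linarith)

/-- The integrand of `Kpq` is bounded uniformly for `k ∈ [0, c]`. -/
theorem kernel_rpow_le {p q k c s : ℝ} (hp : 0 < p) (hq : 1 ≤ q) (hk0 : 0 ≤ k) (hkc : k ≤ c)
    (hc : c < 1) (hs0 : 0 ≤ s) (hs1 : s < 1) :
    ((1 - s ^ q) * (1 - k ^ q * s ^ q)) ^ (-(1 / p)) ≤
      (1 - c) ^ (-(1 / p)) * (1 - s) ^ (-(1 / p)) := by
  rw [← Real.mul_rpow (sub_nonneg.2 hc.le) (sub_nonneg.2 hs1.le)]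
  have hp' : 0 < 1 / p := by positivity
  refine Real.rpow_le_rpow_of_nonpos (mul_pos (sub_pos.2 hc) (sub_pos.2 hs1)) ?_ (neg_nonpos.2 hp'.le)
  refine le_trans ?_ (kernel_lower hq hk0 (hkc.trans hc.le) hs0 hs1.le)
  rw [mul_comm]
  have : k * s ≤ k := mul_le_of_le_one_right hk0 hs1.le
  exact mul_le_mul_of_nonneg_left (by linarith) (by linarith)

theorem intervalIntegrable_one_sub_rpow {r : ℝ} (hr : -1 < r) :
    IntervalIntegrable (fun s : ℝ => (1 - s) ^ r) volume 0 1 := by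
  simpa using ((intervalIntegral.intervalIntegrable_rpow' (a := 0) (b := 1) hr).comp_sub_left 1).symm

theorem intervalIntegrable_kernel {p q k : ℝ} (hp : 1 < p) (hq : 1 ≤ q) (hk0 : 0 ≤ k)
    (hk1 : k < 1) :
    IntervalIntegrable (fun s : ℝ => ((1 - s ^ q) * (1 - k ^ q * s ^ q)) ^ (-(1 / p)))
      volume 0 1 := by
  have hr : -1 < -(1 / p) := by
    have : 1 / p < 1 := (div_lt_one (by linarith)).2 hp
    linarith
  refine ((intervalIntegrable_one_sub_rpow hr).const_mul ((1 - k) ^ (-(1 / p)))).mono_fun' ?_ ?_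
  · exact Measurable.aestronglyMeasurable (by fun_prop)
  · rw [Filter.EventuallyLE, ae_restrict_iff' measurableSet_uIoc]
    filter_upwards [Measure.ae_ne volume (1 : ℝ)] with s hs1 hs
    rw [uIoc_of_le zero_le_one] at hs
    have hs1 : s < 1 := lt_of_le_of_ne hs.2 hs1
    rw [Real.norm_of_nonneg (Real.rpow_nonneg (kernel_pos hq hk0 hk1.le hs.1.le hs1).le _)]
    exact kernel_rpow_le (by linarith) hq hk0 le_rfl hk1 hs.1.le hs1

theorem Kpq_pos {p q k : ℝ} (hp : 1 < p) (hq : 1 ≤ q) (hk0 : 0 ≤ k) (hk1 : k < 1) :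
    0 < Kpq p q k :=
  intervalIntegral.intervalIntegral_pos_of_pos_on (intervalIntegrable_kernel hp hq hk0 hk1)
    (fun _ hs => Real.rpow_pos_of_pos (kernel_pos hq hk0 hk1.le hs.1.le hs.2) _) zero_lt_one

theorem Kpq_strictMonoOn {p q : ℝ} (hp : 1 < p) (hq : 1 ≤ q) :
    StrictMonoOn (Kpq p q) (Ico 0 1) := by
  intro a ha b hb hab
  have hIa := intervalIntegrable_kernel (p := p) hp hq ha.1 ha.2
  have hIb := intervalIntegrable_kernel (p := p) hp hq hb.1 hb.2
  rw [← sub_pos]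
  unfold Kpq arcsnPQ
  rw [← intervalIntegral.integral_sub hIb hIa]
  refine intervalIntegral.intervalIntegral_pos_of_pos_on (hIb.sub hIa) (fun s hs => ?_) zero_lt_one
  have hp' : 0 < 1 / p := by positivity
  refine sub_pos.2 (Real.rpow_lt_rpow_of_neg (kernel_pos hq hb.1 hb.2.le hs.1.le hs.2) ?_
    (by linarith))
  have h1 : s ^ q < 1 := Real.rpow_lt_one hs.1.le hs.2 (by linarith)
  have h2 : a ^ q < b ^ q := Real.rpow_lt_rpow ha.1 hab (by linarith)
  have h3 : 0 < s ^ q := Real.rpow_pos_of_pos hs.1 _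
  exact mul_lt_mul_of_pos_left (by nlinarith) (by linarith)

/-- Dominated convergence for `Kpq` as `k → c`, for `k` in a subset of `[0, 1]`. -/
theorem tendsto_Kpq {p q c : ℝ} {l : Filter ℝ} [l.IsCountablyGenerated] (hq : 1 ≤ q)
    (hc : c ∈ Icc (0 : ℝ) 1) (hl : l ≤ nhds c)
    (hl' : ∀ᶠ k in l, k ∈ Icc (0 : ℝ) 1) (bound : ℝ → ℝ)
    (hbound : IntervalIntegrable bound volume 0 1)
    (hle : ∀ᶠ k in l, ∀ s ∈ Ico (0 : ℝ) 1,
      ((1 - s ^ q) * (1 - k ^ q * s ^ q)) ^ (-(1 / p)) ≤ bound s) :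
    Tendsto (Kpq p q) l (nhds (Kpq p q c)) := by
  refine intervalIntegral.tendsto_integral_filter_of_dominated_convergence bound ?_ ?_ hbound ?_
  · exact Eventually.of_forall fun k => Measurable.aestronglyMeasurable (by fun_prop)
  · filter_upwards [hl', hle] with k hk hk'
    filter_upwards [Measure.ae_ne volume (1 : ℝ)] with s hs1 hs
    rw [uIoc_of_le zero_le_one] at hs
    have hs1 : s < 1 := lt_of_le_of_ne hs.2 hs1
    rw [Real.norm_of_nonneg (Real.rpow_nonneg (kernel_pos hq hk.1 hk.2 hs.1.le hs1).le _)]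
    exact hk' s ⟨hs.1.le, hs1⟩
  · filter_upwards [Measure.ae_ne volume (1 : ℝ)] with s hs1 hs
    rw [uIoc_of_le zero_le_one] at hs
    have hs1 : s < 1 := lt_of_le_of_ne hs.2 hs1
    have hpow : Tendsto (fun k : ℝ => k ^ q) l (nhds (c ^ q)) :=
      (Real.continuousAt_rpow_const c q (Or.inr (by linarith))).tendsto.mono_left hl
    exact (((hpow.mul_const _).const_sub 1).const_mul _).rpow_const
      (Or.inl (kernel_pos hq hc.1 hc.2 hs.1.le hs1).ne')

theorem tendsto_Kpq_zero {p q : ℝ} (hp : 1 < p) (hq : 1 ≤ q) :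
    Tendsto (Kpq p q) (nhdsWithin 0 (Ioi 0)) (nhds (piPQ p q / 2)) := by
  have h0 : Kpq p q 0 = piPQ p q / 2 := by
    simp [Kpq, piPQ, arcsnPQ, arcsinPQ, Real.zero_rpow (by linarith : q ≠ 0)]
  have hr : -1 < -(1 / p) := by
    have : 1 / p < 1 := (div_lt_one (by linarith)).2 hp
    linarith
  have hk : ∀ᶠ k : ℝ in nhdsWithin 0 (Ioi 0), k ∈ Ioo (0 : ℝ) (1 / 2) :=
    Ioo_mem_nhdsGT (by norm_num)
  rw [← h0]
  refine tendsto_Kpq hq (by simp) nhdsWithin_le_nhds ?_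
    (fun s => (1 - 1 / 2) ^ (-(1 / p)) * (1 - s) ^ (-(1 / p)))
    ((intervalIntegrable_one_sub_rpow hr).const_mul _) ?_
  · filter_upwards [hk] with k hk
    exact ⟨hk.1.le, by linarith [hk.2]⟩
  · filter_upwards [hk] with k hk s hs
    exact kernel_rpow_le (by linarith) hq hk.1.le hk.2.le (by norm_num) hs.1 hs.2

theorem Kpq_one {p q : ℝ} (hq : 1 ≤ q) : Kpq p q 1 = piPQ (p / 2) q / 2 := by
  simp only [Kpq, piPQ, arcsnPQ, arcsinPQ, Real.one_rpow, one_mul]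
  rw [mul_div_cancel_left₀ _ two_ne_zero]
  refine intervalIntegral.integral_congr fun s hs => ?_
  rw [uIcc_of_le zero_le_one] at hs
  have h1 : s ^ q ≤ 1 := Real.rpow_le_one hs.1 hs.2 (by linarith)
  rw [← pow_two, ← Real.rpow_natCast, ← Real.rpow_mul (by linarith)]
  congr 1
  push_cast
  rw [one_div_div]
  ring

theorem tendsto_Kpq_one {p q : ℝ} (hp : 2 < p) (hq : 1 ≤ q) :
    Tendsto (Kpq p q) (nhdsWithin 1 (Iio 1)) (nhds (piPQ (p / 2) q / 2)) := by
  have hr : -1 < 2 * -(1 / p) := by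
    have : 1 / p < 1 / 2 := one_div_lt_one_div_of_lt (by norm_num) hp
    linarith
  have hk : ∀ᶠ k : ℝ in nhdsWithin 1 (Iio 1), k ∈ Ioo (0 : ℝ) 1 :=
    Ioo_mem_nhdsLT (by norm_num)
  have hp' : 0 < 1 / p := by positivity
  rw [← Kpq_one hq]
  refine tendsto_Kpq hq (by simp) nhdsWithin_le_nhds ?_
    (fun s => (1 - s) ^ (2 * -(1 / p))) (intervalIntegrable_one_sub_rpow hr) ?_
  · filter_upwards [hk] with k hk
    exact ⟨hk.1.le, hk.2.le⟩
  · filter_upwards [hk] with k hk s hs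
    have hs1 : 0 < 1 - s := by linarith [hs.2]
    rw [Real.rpow_mul hs1.le]
    refine Real.rpow_le_rpow_of_nonpos (Real.rpow_pos_of_pos hs1 _) ?_ (by linarith)
    refine le_trans ?_ (kernel_lower hq hk.1.le hk.2.le hs.1 hs.2.le)
    rw [Real.rpow_two, pow_two]
    have : k * s ≤ s := mul_le_of_le_one_left hs.1 hk.2.le
    exact mul_le_mul_of_nonneg_left (by linarith) hs1.le

/-- Logarithmic lower bound for `Kpq` in the divergent range `p ≤ 2`. -/
theorem log_le_Kpq {p q k : ℝ} (hp : 1 < p) (hp2 : p ≤ 2) (hq : 1 ≤ q) (hk0 : 0 < k)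
    (hk1 : k < 1) : (2 * q)⁻¹ * -Real.log (1 - k) ≤ Kpq p q k := by
  have hI := intervalIntegrable_kernel hp hq hk0.le hk1
  have hsub : uIcc 0 k ⊆ uIcc (0 : ℝ) 1 := by
    rw [uIcc_of_le hk0.le, uIcc_of_le zero_le_one]
    exact Icc_subset_Icc_right hk1.le
  have hlog : ∫ s in (0 : ℝ)..k, (2 * q)⁻¹ * (1 - s)⁻¹ = (2 * q)⁻¹ * -Real.log (1 - k) := by
    rw [intervalIntegral.integral_const_mul,
      intervalIntegral.integral_comp_sub_left (fun x : ℝ => x⁻¹) 1,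
      integral_inv_of_pos (by linarith) (by norm_num)]
    simp
  have hint : IntervalIntegrable (fun s : ℝ => (2 * q)⁻¹ * (1 - s)⁻¹) volume 0 k := by
    refine ContinuousOn.intervalIntegrable ?_
    rw [uIcc_of_le hk0.le]
    refine continuousOn_const.mul (ContinuousOn.inv₀ (by fun_prop) fun s hs => ?_)
    linarith [hs.2]
  rw [← hlog]
  calc ∫ s in (0 : ℝ)..k, (2 * q)⁻¹ * (1 - s)⁻¹
      ≤ ∫ s in (0 : ℝ)..k, ((1 - s ^ q) * (1 - k ^ q * s ^ q)) ^ (-(1 / p)) := by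
        refine intervalIntegral.integral_mono_on hk0.le hint (hI.mono_set hsub) fun s hs => ?_
        have hs1 : s < 1 := by linarith [hs.2]
        have hX := kernel_pos hq hk0.le hk1.le hs.1 hs1
        have hsk : s ^ q ≤ k ^ q := Real.rpow_le_rpow hs.1 hs.2 (by linarith)
        have hs0 : 0 ≤ s ^ q := Real.rpow_nonneg hs.1 _
        have hsq : s ^ q < 1 := Real.rpow_lt_one hs.1 hs1 (by linarith)
        have hbern : 1 - s ^ q ≤ q * (1 - s) := by
          have := one_add_mul_self_le_rpow_one_add (s := s - 1) (by linarith [hs.1]) hq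
          rw [add_sub_cancel] at this
          linarith
        have hks := mul_le_mul_of_nonneg_right hsk hs0
        have hle : (1 - s ^ q) * (1 - k ^ q * s ^ q) ≤ (2 * q * (1 - s)) ^ 2 :=
          calc (1 - s ^ q) * (1 - k ^ q * s ^ q) ≤ (1 - s ^ q) * (1 - s ^ q * s ^ q) :=
                mul_le_mul_of_nonneg_left (by linarith) (by linarith)
            _ ≤ (2 * (1 - s ^ q)) ^ 2 := by
                nlinarith [sq_nonneg (1 - s ^ q), mul_nonneg (sq_nonneg (1 - s ^ q)) hs0]
            _ ≤ (2 * q * (1 - s)) ^ 2 := pow_le_pow_left₀ (by linarith) (by linarith) 2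
        have hX1 : (1 - s ^ q) * (1 - k ^ q * s ^ q) ≤ 1 :=
          (mul_le_of_le_one_right (by linarith) (by nlinarith)).trans (by linarith)
        have hb : 0 < 2 * q * (1 - s) := mul_pos (by linarith) (by linarith)
        have hp' : 1 / 2 ≤ 1 / p := one_div_le_one_div_of_le (by linarith) hp2
        calc (2 * q)⁻¹ * (1 - s)⁻¹ = ((2 * q * (1 - s)) ^ 2) ^ (-(1 / 2 : ℝ)) := by
              rw [← Real.rpow_two, ← Real.rpow_mul hb.le, ← mul_inv]
              norm_num [Real.rpow_neg_one]
          _ ≤ ((1 - s ^ q) * (1 - k ^ q * s ^ q)) ^ (-(1 / 2 : ℝ)) :=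
              Real.rpow_le_rpow_of_nonpos hX hle (by norm_num)
          _ ≤ _ := Real.rpow_le_rpow_of_exponent_ge hX hX1 (by linarith)
    _ ≤ Kpq p q k := by
        refine intervalIntegral.integral_mono_interval le_rfl hk0.le hk1.le ?_ hI
        rw [Filter.EventuallyLE, ae_restrict_iff' measurableSet_Ioc]
        filter_upwards [Measure.ae_ne volume (1 : ℝ)] with s hs1 hs
        exact Real.rpow_nonneg
          (kernel_pos hq hk0.le hk1.le hs.1.le (lt_of_le_of_ne hs.2 hs1)).le _

theorem tendsto_Kpq_atTop {p q : ℝ} (hp : 1 < p) (hp2 : p ≤ 2) (hq : 1 ≤ q) :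
    Tendsto (Kpq p q) (nhdsWithin 1 (Iio 1)) atTop := by
  have hsub : Tendsto (fun k : ℝ => 1 - k) (nhdsWithin 1 (Iio 1)) (nhdsWithin 0 (Ioi 0)) := by
    refine tendsto_nhdsWithin_iff.2 ⟨?_, ?_⟩
    · have : Tendsto (fun k : ℝ => 1 - k) (nhds 1) (nhds (1 - 1)) :=
        Continuous.tendsto (by fun_prop) 1
      rw [sub_self] at this
      exact this.mono_left nhdsWithin_le_nhds
    · filter_upwards [self_mem_nhdsWithin] with k hk
      exact sub_pos.2 (mem_Iio.1 hk)
  have hlog := tendsto_neg_atBot_atTop.comp (Real.tendsto_log_nhdsGT_zero.comp hsub)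
  refine tendsto_atTop_mono' _ ?_ (hlog.const_mul_atTop (by positivity : 0 < (2 * q)⁻¹))
  filter_upwards [Ioo_mem_nhdsLT (by norm_num : (0 : ℝ) < 1)] with k hk
  exact log_le_Kpq hp hp2 hq hk.1 hk.2

/-- The algebraic prefactor of `PhiFun` is continuous on `[0, ∞)` for nonnegative exponent. -/
theorem tendsto_prefactor {p q c : ℝ} (hq : 0 < q) (hc : 0 ≤ c) (h : 0 ≤ 1 / q - 1 / p) :
    Tendsto (fun k : ℝ => (1 + k ^ q) ^ (1 / p) * (2 * k ^ q / (1 + k ^ q)) ^ (1 / q - 1 / p))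
      (nhds c)
      (nhds ((1 + c ^ q) ^ (1 / p) * (2 * c ^ q / (1 + c ^ q)) ^ (1 / q - 1 / p))) := by
  have hpow : Tendsto (fun k : ℝ => k ^ q) (nhds c) (nhds (c ^ q)) :=
    (Real.continuousAt_rpow_const c q (Or.inr hq.le)).tendsto
  have hc' : 0 ≤ c ^ q := Real.rpow_nonneg hc _
  have hne : 1 + c ^ q ≠ 0 := by positivity
  exact ((hpow.const_add 1).rpow_const (Or.inl hne)).mul
    (((hpow.const_mul 2).div (hpow.const_add 1) hne).rpow_const (Or.inr h))

theorem stmt16 (p q : ℝ) (hq : 1 < q) (hpq : q ≤ p) :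
    StrictMonoOn (PhiFun p q) (Ioo 0 1) ∧
    (q < p → Tendsto (PhiFun p q) (nhdsWithin 0 (Ioi 0)) (nhds 0)) ∧
    (p = q → Tendsto (PhiFun p q) (nhdsWithin 0 (Ioi 0)) (nhds (piPQ p q / 2))) ∧
    (p ≤ 2 → Tendsto (PhiFun p q) (nhdsWithin 1 (Iio 1)) atTop) ∧
    (2 < p → Tendsto (PhiFun p q) (nhdsWithin 1 (Iio 1))
      (nhds ((2 : ℝ) ^ (1 / p - 1) * piPQ (p / 2) q))) := by
  have hp : 1 < p := by linarith
  have hq1 : 1 ≤ q := hq.le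
  have hq0 : 0 < q := by linarith
  have he : 0 ≤ 1 / q - 1 / p := sub_nonneg.2 (one_div_le_one_div_of_le hq0 hpq)
  have hpre0 := (tendsto_prefactor (p := p) hq0 le_rfl he).mono_left
    (nhdsWithin_le_nhds (s := Ioi 0))
  have hpre1 := (tendsto_prefactor (p := p) hq0 zero_le_one he).mono_left
    (nhdsWithin_le_nhds (s := Iio 1))
  have hval : (1 + (1 : ℝ) ^ q) ^ (1 / p) * (2 * (1 : ℝ) ^ q / (1 + (1 : ℝ) ^ q)) ^ (1 / q - 1 / p)
      = 2 ^ (1 / p) := by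
    norm_num
  rw [hval] at hpre1
  rw [Real.zero_rpow hq0.ne', add_zero, Real.one_rpow, one_mul, mul_zero, zero_div] at hpre0
  refine ⟨fun a ha b hb hab => ?_, fun hlt => ?_, fun heq => ?_, fun hp2 => ?_, fun hp2 => ?_⟩
  · have hK := Kpq_strictMonoOn hp hq1 ⟨ha.1.le, ha.2⟩ ⟨hb.1.le, hb.2⟩ hab
    have hKa := Kpq_pos hp hq1 ha.1.le ha.2
    have ha0 : 0 < a ^ q := Real.rpow_pos_of_pos ha.1 _
    have hb0 : 0 < b ^ q := Real.rpow_pos_of_pos hb.1 _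
    have habq : a ^ q ≤ b ^ q := Real.rpow_le_rpow ha.1.le hab.le hq0.le
    refine mul_lt_mul' (mul_le_mul ?_ ?_ (by positivity) (by positivity)) hK hKa.le (by positivity)
    · exact Real.rpow_le_rpow (by positivity) (by linarith) (by positivity)
    · refine Real.rpow_le_rpow (by positivity) ?_ he
      rw [div_le_div_iff₀ (by positivity) (by positivity)]
      nlinarith
  · have he' : 1 / q - 1 / p ≠ 0 := (sub_pos.2 (one_div_lt_one_div_of_lt hq0 hlt)).ne'
    rw [Real.zero_rpow he'] at hpre0
    have h := hpre0.mul (tendsto_Kpq_zero hp hq1)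
    rw [zero_mul] at h
    exact h
  · have he' : 1 / q - 1 / p = 0 := by rw [heq, sub_self]
    have h := hpre0.mul (tendsto_Kpq_zero hp hq1)
    rw [show (0 : ℝ) ^ (1 / q - 1 / p) = 1 by rw [he', Real.rpow_zero], one_mul] at h
    exact h
  · exact hpre1.pos_mul_atTop (by positivity) (tendsto_Kpq_atTop hp hp2 hq1)
  · have h := hpre1.mul (tendsto_Kpq_one hp2 hq1)
    rw [mul_div_assoc', ← div_mul_eq_mul_div] at h
    rw [Real.rpow_sub two_pos, Real.rpow_one]
    exact h
end

section
/- Let 1 < p < q. Then the function ψ(t) = t^{1/q−1/p}·(1−t)^{−1/p} is strictly log-convex on (0,1) (indeed (log ψ)''(t) = (1/p−1/q)/t² + (1/p)/(1−t)² > 0), and consequently the function Φ(k) = (1+k^q)^{1/p}·(2k^q/(1+k^q))^{1/q−1/p}·K_{pq}(k), which tends to +∞ both as k → 0+ and as k → 1− when p ≤ 2, has exactly one critical point k_* ∈ (0,1) when 1 < p ≤ 2, at which Φ attains its minimum over (0,1). -/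
open Real Set Filter MeasureTheory

lemma hasDerivAt_log_rpow_mul_rpow {a b t : ℝ} (ht : t ∈ Ioo (0 : ℝ) 1) :
    HasDerivAt (fun s : ℝ => Real.log (s ^ a * (1 - s) ^ b)) (a / t - b / (1 - t)) t := by
  have h1 : 0 < 1 - t := by linarith [ht.2]
  have key : HasDerivAt (fun s : ℝ => a * Real.log s + b * Real.log (1 - s))
      (a / t - b / (1 - t)) t := by
    refine (((Real.hasDerivAt_log ht.1.ne').const_mul a).add
      ((((hasDerivAt_id' t).const_sub 1).log h1.ne').const_mul b)).congr_deriv ?_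
    ring
  refine key.congr_of_eventuallyEq ?_
  filter_upwards [Ioo_mem_nhds ht.1 ht.2] with s hs
  have h2 : 0 < 1 - s := by linarith [hs.2]
  rw [Real.log_mul (rpow_pos_of_pos hs.1 _).ne' (rpow_pos_of_pos h2 _).ne', Real.log_rpow hs.1,
    Real.log_rpow h2]

lemma deriv_deriv_log_rpow_mul_rpow {a b t : ℝ} (ht : t ∈ Ioo (0 : ℝ) 1) :
    deriv (deriv fun s : ℝ => Real.log (s ^ a * (1 - s) ^ b)) t
      = -a / t ^ 2 + -b / (1 - t) ^ 2 := by
  have h1 : 1 - t ≠ 0 := by linarith [ht.2]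
  have h0 : t ≠ 0 := ht.1.ne'
  have he : (deriv fun s : ℝ => Real.log (s ^ a * (1 - s) ^ b))
      =ᶠ[nhds t] fun s => a * s⁻¹ - b * (1 - s)⁻¹ := by
    filter_upwards [Ioo_mem_nhds ht.1 ht.2] with s hs
    rw [(hasDerivAt_log_rpow_mul_rpow hs).deriv, div_eq_mul_inv, div_eq_mul_inv]
  rw [he.deriv_eq]
  refine HasDerivAt.deriv ?_
  refine (((hasDerivAt_inv h0).const_mul a).sub
    ((((hasDerivAt_id' t).const_sub 1).fun_inv h1).const_mul b)).congr_deriv ?_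
  ring

lemma strictConvexOn_log_rpow_mul_rpow {a b : ℝ} (ha : a < 0) (hb : b < 0) :
    StrictConvexOn ℝ (Ioo 0 1) fun t : ℝ => Real.log (t ^ a * (1 - t) ^ b) := by
  refine strictConvexOn_of_deriv2_pos' (convex_Ioo 0 1)
    (fun t ht => (hasDerivAt_log_rpow_mul_rpow ht).continuousAt.continuousWithinAt) ?_
  intro t ht
  have h0 := ht.1
  have h1 : 0 < 1 - t := by linarith [ht.2]
  have ha' : 0 < -a := by linarith
  have hb' : 0 < -b := by linarith
  simp only [Function.iterate_succ, Function.iterate_zero, Function.comp_apply, id]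
  rw [deriv_deriv_log_rpow_mul_rpow ht]
  positivity

lemma strictConvexOn_rpow_mul_rpow {a b : ℝ} (ha : a < 0) (hb : b < 0) :
    StrictConvexOn ℝ (Ioo 0 1) fun t : ℝ => t ^ a * (1 - t) ^ b := by
  have hexp : ∀ t ∈ Ioo (0 : ℝ) 1,
      Real.exp (Real.log (t ^ a * (1 - t) ^ b)) = t ^ a * (1 - t) ^ b := fun t ht =>
    Real.exp_log (mul_pos (rpow_pos_of_pos ht.1 _) (rpow_pos_of_pos (by linarith [ht.2]) _))
  refine ⟨convex_Ioo 0 1, fun x hx y hy hxy c d hc hd hcd => ?_⟩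
  have h := Real.exp_lt_exp.2 ((strictConvexOn_log_rpow_mul_rpow ha hb).2 hx hy hxy hc hd hcd)
  rw [hexp _ (convex_Ioo 0 1 hx hy hc.le hd.le hcd)] at h
  refine h.trans_le ((convexOn_exp.2 (mem_univ _) (mem_univ _) hc.le hd.le hcd).trans_eq ?_)
  rw [hexp x hx, hexp y hy]

lemma one_sub_le_one_sub_rpow {q s : ℝ} (hq : 1 ≤ q) (h0 : 0 ≤ s) (h1 : s ≤ 1) :
    1 - s ≤ 1 - s ^ q := by
  have := rpow_le_rpow_of_exponent_ge' h0 h1 zero_le_one hq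
  rw [rpow_one] at this
  linarith

lemma intervalIntegrable_one_sub_rpow_rpow {q b : ℝ} (hq : 1 ≤ q) (hb0 : 0 ≤ b) (hb : b < 1) :
    IntervalIntegrable (fun s : ℝ => (1 - s ^ q) ^ (-b)) volume 0 1 := by
  have h : IntervalIntegrable (fun s : ℝ => (1 - s) ^ (-b)) volume 0 1 := by
    have := (intervalIntegral.intervalIntegrable_rpow' (a := 1) (b := 0)
      (show -1 < -b by linarith)).comp_sub_left 1
    simpa using this
  refine h.mono_fun (Measurable.aestronglyMeasurable (by fun_prop)) ?_
  rw [uIoc_of_le zero_le_one, EventuallyLE, ← restrict_Ioo_eq_restrict_Ioc]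
  refine (ae_restrict_iff' measurableSet_Ioo).2 (Eventually.of_forall fun s hs => ?_)
  have h1 : 0 < 1 - s := by linarith [hs.2]
  have h2 := one_sub_le_one_sub_rpow hq hs.1.le hs.2.le
  rw [Real.norm_of_nonneg (rpow_nonneg (h1.le.trans h2) _), Real.norm_of_nonneg (by positivity)]
  exact rpow_le_rpow_of_nonpos h1 h2 (by linarith)

lemma one_sub_mul_rpow_pos {q u s : ℝ} (hq : 0 < q) (hu : u < 1) (hs : s ∈ Icc (0 : ℝ) 1) :
    0 < 1 - u * s ^ q := by
  have h0 := rpow_nonneg hs.1 q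
  have h1 := rpow_le_one hs.1 hs.2 hq.le
  rcases h1.lt_or_eq with h | h
  · nlinarith
  · rw [h]
    linarith

lemma intervalIntegrable_mul_rpow {q b u : ℝ} (hq : 1 ≤ q) (hb0 : 0 ≤ b) (hb : b < 1)
    (hu : u < 1) (e : ℝ) :
    IntervalIntegrable (fun s : ℝ => (1 - s ^ q) ^ (-b) * (1 - u * s ^ q) ^ e) volume 0 1 := by
  refine (intervalIntegrable_one_sub_rpow_rpow hq hb0 hb).mul_continuousOn ?_
  rw [uIcc_of_le zero_le_one]
  refine ContinuousOn.rpow_const ?_ fun s hs => Or.inl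
    (one_sub_mul_rpow_pos (by linarith) hu hs).ne'
  exact (continuous_const.sub (continuous_const.mul
    (continuous_id.rpow_const fun _ => Or.inr (by linarith)))).continuousOn

lemma differentiableAt_integral_mul_rpow {q b u : ℝ} (hq : 1 ≤ q) (hb0 : 0 ≤ b) (hb : b < 1)
    (hu0 : 0 < u) (hu : u < 1) :
    DifferentiableAt ℝ
      (fun u : ℝ => ∫ s in (0 : ℝ)..1, (1 - s ^ q) ^ (-b) * (1 - u * s ^ q) ^ (-b)) u := by
  obtain ⟨v, huv, hv⟩ := exists_between hu
  refine (intervalIntegral.hasDerivAt_integral_of_dominated_loc_of_deriv_le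
    (F' := fun u s => (1 - s ^ q) ^ (-b) * (-s ^ q * (-b) * (1 - u * s ^ q) ^ (-b - 1)))
    (bound := fun s => (1 - s ^ q) ^ (-b) * (b * (1 - v) ^ (-b - 1)))
    (Ioo_mem_nhds hu0 huv) ?_ (intervalIntegrable_mul_rpow hq hb0 hb hu _) ?_ ?_
    ((intervalIntegrable_one_sub_rpow_rpow hq hb0 hb).mul_const _) ?_).2.differentiableAt
  · exact Eventually.of_forall fun x => Measurable.aestronglyMeasurable (by fun_prop)
  · exact Measurable.aestronglyMeasurable (by fun_prop)
  · refine Eventually.of_forall fun s hs x hx => ?_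
    rw [uIoc_of_le zero_le_one] at hs
    have h0 : 0 ≤ s ^ q := rpow_nonneg hs.1.le q
    have h1 := rpow_le_one hs.1.le hs.2 (by linarith : (0 : ℝ) ≤ q)
    have h2 : 1 - v ≤ 1 - x * s ^ q := by nlinarith [hx.1, hx.2]
    have hv' : 0 < 1 - v := by linarith
    have h3 := rpow_le_rpow_of_nonpos hv' h2 (by linarith : -b - 1 ≤ 0)
    have h4 : 0 ≤ (1 - x * s ^ q) ^ (-b - 1) := rpow_nonneg (hv'.le.trans h2) _
    have h5 : 0 ≤ (1 - s ^ q) ^ (-b) := rpow_nonneg (by linarith) _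
    rw [show -s ^ q * (-b) * (1 - x * s ^ q) ^ (-b - 1)
      = s ^ q * b * (1 - x * s ^ q) ^ (-b - 1) by ring, Real.norm_of_nonneg (by positivity)]
    refine mul_le_mul_of_nonneg_left (mul_le_mul ?_ h3 h4 hb0) h5
    nlinarith
  · refine Eventually.of_forall fun s hs x hx => ?_
    rw [uIoc_of_le zero_le_one] at hs
    have h2 := one_sub_mul_rpow_pos (q := q) (by linarith) (hx.2.trans hv) (Ioc_subset_Icc_self hs)
    refine HasDerivAt.const_mul _ (HasDerivAt.rpow_const ?_ (Or.inl h2.ne'))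
    simpa using ((hasDerivAt_id x).mul_const (s ^ q)).const_sub 1

lemma Kpq_eq {p q k : ℝ} (hq : 0 < q) (hk : k ∈ Ioo (0 : ℝ) 1) :
    Kpq p q k
      = ∫ s in (0 : ℝ)..1, (1 - s ^ q) ^ (-(1 / p)) * (1 - k ^ q * s ^ q) ^ (-(1 / p)) := by
  refine intervalIntegral.integral_congr fun s hs => ?_
  rw [uIcc_of_le zero_le_one] at hs
  refine mul_rpow ?_ (one_sub_mul_rpow_pos hq (rpow_lt_one hk.1.le hk.2 hq) hs).le
  linarith [rpow_le_one hs.1 hs.2 hq.le]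

lemma differentiableAt_PhiFun {p q k : ℝ} (hp : 1 < p) (hq : 1 ≤ q) (hk : k ∈ Ioo (0 : ℝ) 1) :
    DifferentiableAt ℝ (PhiFun p q) k := by
  have hk0 := hk.1
  have hp1 : 1 / p < 1 := by rw [div_lt_one] <;> linarith
  have hpow : DifferentiableAt ℝ (fun k : ℝ => k ^ q) k :=
    differentiableAt_id.rpow_const (Or.inl hk0.ne')
  have hkq : 0 < k ^ q := rpow_pos_of_pos hk0 q
  have hK : DifferentiableAt ℝ (Kpq p q) k := by
    have h := (differentiableAt_integral_mul_rpow (b := 1 / p) hq (by positivity) hp1 hkq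
      (rpow_lt_one hk0.le hk.2 (by linarith))).comp k hpow
    refine h.congr_of_eventuallyEq ?_
    filter_upwards [Ioo_mem_nhds hk.1 hk.2] with x hx
    exact Kpq_eq (by linarith) hx
  unfold PhiFun
  refine DifferentiableAt.mul (DifferentiableAt.mul ?_ ?_) hK
  · exact (hpow.const_add 1).rpow_const (Or.inl (by positivity))
  · refine DifferentiableAt.rpow_const ?_ (Or.inl (by positivity))
    exact (hpow.const_mul 2).div (hpow.const_add 1) (by positivity)

lemma one_le_rpow_Kpq_integrand {p q k s : ℝ} (hp : 0 < p) (hq : 0 < q) (hk : k ∈ Ioo (0 : ℝ) 1)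
    (hs : s ∈ Ioo (0 : ℝ) 1) :
    1 ≤ (1 - s ^ q) ^ (-(1 / p)) * (1 - k ^ q * s ^ q) ^ (-(1 / p)) := by
  have hb : -(1 / p) ≤ 0 := by
    rw [neg_nonpos]
    positivity
  have hkq : 0 ≤ k ^ q := rpow_nonneg hk.1.le q
  have hs0 : 0 ≤ s ^ q := rpow_nonneg hs.1.le q
  have hs1 : s ^ q < 1 := rpow_lt_one hs.1.le hs.2 hq
  refine one_le_mul_of_one_le_of_one_le ?_ ?_
  · exact one_le_rpow_of_pos_of_le_one_of_nonpos (by linarith) (by linarith) hb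
  · refine one_le_rpow_of_pos_of_le_one_of_nonpos ?_ (by nlinarith) hb
    exact one_sub_mul_rpow_pos hq (rpow_lt_one hk.1.le hk.2 hq) (Ioo_subset_Icc_self hs)

lemma one_le_Kpq {p q k : ℝ} (hp : 1 < p) (hq : 1 ≤ q) (hk : k ∈ Ioo (0 : ℝ) 1) :
    1 ≤ Kpq p q k := by
  have hq0 : 0 < q := by linarith
  rw [Kpq_eq hq0 hk]
  have h := intervalIntegral.integral_mono_on_of_le_Ioo (μ := volume) zero_le_one
    (intervalIntegrable_const (c := (1 : ℝ)))
    (intervalIntegrable_mul_rpow (b := 1 / p) hq (by positivity)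
      (by rw [div_lt_one] <;> linarith) (rpow_lt_one hk.1.le hk.2 hq0) (-(1 / p)))
    (fun s hs => one_le_rpow_Kpq_integrand (by linarith) hq0 hk hs)
  simpa using h

lemma rpow_le_PhiFun {p q k : ℝ} (hp : 1 < p) (hpq : p < q) (hk : k ∈ Ioo (0 : ℝ) 1) :
    (2 * k ^ q) ^ (1 / q - 1 / p) ≤ PhiFun p q k ∧ Kpq p q k ≤ PhiFun p q k := by
  have hK := one_le_Kpq hp (hp.trans hpq).le hk
  have hkq : 0 < k ^ q := rpow_pos_of_pos hk.1 q
  have hkq1 : k ^ q < 1 := rpow_lt_one hk.1.le hk.2 (by linarith)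
  have he : 1 / q - 1 / p ≤ 0 := by
    have := one_div_lt_one_div_of_lt (by linarith : 0 < p) hpq
    linarith
  have h1 : 1 ≤ (1 + k ^ q) ^ (1 / p) := one_le_rpow (by linarith) (by positivity)
  have h2 : (2 * k ^ q) ^ (1 / q - 1 / p) ≤ (2 * k ^ q / (1 + k ^ q)) ^ (1 / q - 1 / p) :=
    rpow_le_rpow_of_nonpos (by positivity) (div_le_self (by positivity) (by linarith)) he
  have h3 : 1 ≤ (2 * k ^ q / (1 + k ^ q)) ^ (1 / q - 1 / p) := by
    refine one_le_rpow_of_pos_of_le_one_of_nonpos (by positivity) ?_ he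
    rw [div_le_one (by positivity)]
    linarith
  unfold PhiFun
  constructor
  · refine h2.trans ?_
    have := one_le_mul_of_one_le_of_one_le h1 hK
    nlinarith
  · exact le_mul_of_one_le_left (by linarith) (one_le_mul_of_one_le_of_one_le h1 h3)

lemma tendsto_PhiFun_zero {p q : ℝ} (hp : 1 < p) (hpq : p < q) :
    Tendsto (PhiFun p q) (nhdsWithin 0 (Ioi 0)) atTop := by
  have hq : 0 < q := by linarith
  have he : 1 / q - 1 / p < 0 := by
    have := one_div_lt_one_div_of_lt (by linarith : 0 < p) hpq
    linarith
  have h0 : Tendsto (fun k : ℝ => 2 * k ^ q) (nhdsWithin 0 (Ioi 0)) (nhdsWithin 0 (Ioi 0)) := by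
    refine tendsto_nhdsWithin_iff.2 ⟨?_, ?_⟩
    · have : Continuous fun k : ℝ => 2 * k ^ q :=
        continuous_const.mul (continuous_id.rpow_const fun _ => Or.inr hq.le)
      simpa [zero_rpow hq.ne'] using (this.tendsto 0).mono_left nhdsWithin_le_nhds
    · filter_upwards [self_mem_nhdsWithin] with k hk
      exact mul_pos two_pos (rpow_pos_of_pos hk q)
  refine tendsto_atTop_mono' _ ?_ ((tendsto_rpow_neg_nhdsGT_zero he).comp h0)
  filter_upwards [Ioo_mem_nhdsGT zero_lt_one] with k hk
  exact (rpow_le_PhiFun hp hpq hk).1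

lemma neg_log_le_Kpq {p q k : ℝ} (hp : 1 < p) (hp2 : p ≤ 2) (hq : 1 ≤ q)
    (hk : k ∈ Ioo (0 : ℝ) 1) : q⁻¹ * -Real.log (1 - k) ≤ Kpq p q k := by
  have hq0 : 0 < q := by linarith
  have hk1 : 0 < 1 - k := by linarith [hk.2]
  have hd : ∀ s ∈ Icc (0 : ℝ) 1, 0 < 2 - k - s := fun s hs => by linarith [hs.2]
  have hc : ContinuousOn (fun s : ℝ => q⁻¹ * (2 - k - s)⁻¹) (uIcc 0 1) := by
    rw [uIcc_of_le zero_le_one]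
    exact continuousOn_const.mul (ContinuousOn.inv₀ (by fun_prop) fun s hs => (hd s hs).ne')
  have hint : ∫ s in (0 : ℝ)..1, q⁻¹ * (2 - k - s)⁻¹
      = q⁻¹ * (Real.log (2 - k) - Real.log (1 - k)) := by
    rw [intervalIntegral.integral_eq_sub_of_hasDerivAt
      (f := fun s => q⁻¹ * -Real.log (2 - k - s)) ?_ hc.intervalIntegrable]
    · rw [show 2 - k - 1 = 1 - k by ring, sub_zero]
      ring
    · intro s hs
      rw [uIcc_of_le zero_le_one] at hs
      refine ((((hasDerivAt_id' s).const_sub (2 - k)).log (hd s hs).ne').neg.const_mul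
        q⁻¹).congr_deriv ?_
      ring
  have hlog : 0 ≤ Real.log (2 - k) := Real.log_nonneg (by linarith)
  calc q⁻¹ * -Real.log (1 - k) ≤ q⁻¹ * (Real.log (2 - k) - Real.log (1 - k)) :=
        mul_le_mul_of_nonneg_left (by linarith) (by positivity)
    _ = ∫ s in (0 : ℝ)..1, q⁻¹ * (2 - k - s)⁻¹ := hint.symm
    _ ≤ Kpq p q k := ?_
  rw [Kpq_eq hq0 hk]
  refine intervalIntegral.integral_mono_on_of_le_Ioo zero_le_one hc.intervalIntegrable
    (intervalIntegrable_mul_rpow (b := 1 / p) hq (by positivity)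
      (by rw [div_lt_one] <;> linarith) (rpow_lt_one hk.1.le hk.2 hq0) (-(1 / p))) ?_
  intro s hs
  have hb : -(1 / p) ≤ 0 := by
    rw [neg_nonpos]
    positivity
  have hb2 : -(1 / p) + -(1 / p) ≤ -1 := by
    have := one_div_le_one_div_of_le (by linarith) hp2
    linarith
  have hkq : 0 < k ^ q := rpow_pos_of_pos hk.1 q
  have hkq1 : k ^ q < 1 := rpow_lt_one hk.1.le hk.2 hq0
  have hs0 : 0 < s ^ q := rpow_pos_of_pos hs.1 q
  have hs1 : s ^ q < 1 := rpow_lt_one hs.1.le hs.2 hq0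
  have hpos : 0 < 1 - k ^ q * s ^ q := by nlinarith
  have hbern : 1 - k ^ q * s ^ q ≤ q * (2 - k - s) := by
    have h := one_add_mul_self_le_rpow_one_add (s := k * s - 1)
      (by nlinarith [hk.1, hs.1]) hq
    rw [add_sub_cancel, mul_rpow hk.1.le hs.1.le] at h
    nlinarith [mul_pos hk1 (sub_pos.2 hs.2)]
  calc q⁻¹ * (2 - k - s)⁻¹ = (q * (2 - k - s))⁻¹ := (mul_inv _ _).symm
    _ ≤ (1 - k ^ q * s ^ q)⁻¹ := inv_anti₀ hpos hbern
    _ = (1 - k ^ q * s ^ q) ^ (-1 : ℝ) := (rpow_neg_one _).symm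
    _ ≤ (1 - k ^ q * s ^ q) ^ (-(1 / p) + -(1 / p)) :=
        rpow_le_rpow_of_exponent_ge hpos (by nlinarith) hb2
    _ = (1 - k ^ q * s ^ q) ^ (-(1 / p)) * (1 - k ^ q * s ^ q) ^ (-(1 / p)) := rpow_add hpos _ _
    _ ≤ _ := mul_le_mul_of_nonneg_right
        (rpow_le_rpow_of_nonpos (by linarith) (by nlinarith) hb) (rpow_nonneg hpos.le _)

lemma tendsto_PhiFun_one {p q : ℝ} (hp : 1 < p) (hp2 : p ≤ 2) (hpq : p < q) :
    Tendsto (PhiFun p q) (nhdsWithin 1 (Iio 1)) atTop := by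
  have h0 : Tendsto (fun k : ℝ => 1 - k) (nhdsWithin 1 (Iio 1)) (nhdsWithin 0 (Ioi 0)) := by
    refine tendsto_nhdsWithin_iff.2 ⟨?_, ?_⟩
    · have : Continuous fun k : ℝ => 1 - k := by fun_prop
      simpa using (this.tendsto 1).mono_left nhdsWithin_le_nhds
    · filter_upwards [self_mem_nhdsWithin] with k hk
      exact sub_pos.2 (mem_Iio.1 hk)
  refine tendsto_atTop_mono' _ ?_ ((tendsto_neg_atBot_atTop.comp
    (Real.tendsto_log_nhdsGT_zero.comp h0)).const_mul_atTop (r := q⁻¹) (by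
      rw [inv_pos]
      linarith))
  filter_upwards [Ioo_mem_nhdsLT zero_lt_one] with k hk
  exact (neg_log_le_Kpq hp hp2 (hp.trans hpq).le hk).trans (rpow_le_PhiFun hp hpq hk).2

lemma ContinuousOn.exists_isMinOn_Ioo_of_tendsto_atTop {f : ℝ → ℝ} {a b : ℝ} (hab : a < b)
    (hf : ContinuousOn f (Ioo a b)) (ha : Tendsto f (nhdsWithin a (Ioi a)) atTop)
    (hb : Tendsto f (nhdsWithin b (Iio b)) atTop) : ∃ x ∈ Ioo a b, IsMinOn f (Ioo a b) x := by
  obtain ⟨m, hm⟩ := exists_between hab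
  obtain ⟨u, hu, hu'⟩ := (mem_nhdsGT_iff_exists_Ioo_subset' hm.1).1
    (ha.eventually_ge_atTop (f m))
  obtain ⟨v, hv, hv'⟩ := (mem_nhdsLT_iff_exists_Ioo_subset' hm.2).1
    (hb.eventually_ge_atTop (f m))
  have hmem : m ∈ Icc (min u m) (max v m) := ⟨min_le_right _ _, le_max_right _ _⟩
  have hsub : Icc (min u m) (max v m) ⊆ Ioo a b := fun x hx =>
    ⟨(lt_min hu hm.1).trans_le hx.1, hx.2.trans_lt (max_lt hv hm.2)⟩
  obtain ⟨x, hx, hmin⟩ := isCompact_Icc.exists_isMinOn ⟨m, hmem⟩ (hf.mono hsub)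
  refine ⟨x, hsub hx, fun y hy => ?_⟩
  by_cases hyu : y < min u m
  · exact le_trans (b := f m) (hmin hmem) (hu' ⟨hy.1, hyu.trans_le (min_le_left _ _)⟩)
  by_cases hyv : max v m < y
  · exact le_trans (b := f m) (hmin hmem) (hv' ⟨(le_max_left _ _).trans_lt hyv, hy.2⟩)
  exact hmin ⟨not_lt.1 hyu, not_lt.1 hyv⟩

lemma rpow_div_one_sub_mem {q r : ℝ} (hq : 0 < q) (hr : r ∈ Ioo (0 : ℝ) (1 / 2)) :
    (r / (1 - r)) ^ (1 / q) ∈ Ioo (0 : ℝ) 1 := by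
  have h1 : 0 < 1 - r := by linarith [hr.2]
  have h2 : 0 < r / (1 - r) := div_pos hr.1 h1
  refine ⟨rpow_pos_of_pos h2 _, rpow_lt_one h2.le ?_ (by positivity)⟩
  rw [div_lt_one h1]
  linarith [hr.2]

lemma const_mul_PhiFun_integrand {p q r s : ℝ} (hq : 0 < q) (hr : r ∈ Ioo (0 : ℝ) (1 / 2))
    (hs : s ∈ Icc (0 : ℝ) 1) :
    (1 - r) ^ (-(1 / p)) * (2 * r) ^ (1 / q - 1 / p) *
        ((1 - s ^ q) ^ (-(1 / p)) * (1 - r / (1 - r) * s ^ q) ^ (-(1 / p)))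
      = 2 ^ (1 / q - 1 / p) * (1 + s ^ q) ^ (-(1 / q - 1 / p)) * (1 - s ^ q) ^ (-(1 / p)) *
        (((1 + s ^ q) * r) ^ (1 / q - 1 / p) * (1 - (1 + s ^ q) * r) ^ (-(1 / p))) := by
  have h1 : 0 < 1 - r := by linarith [hr.2]
  have hs0 : 0 ≤ s ^ q := rpow_nonneg hs.1 q
  have hs1 : s ^ q ≤ 1 := rpow_le_one hs.1 hs.2 hq.le
  have h2 : 0 < 1 + s ^ q := by linarith
  have h3 : 0 < 1 - r / (1 - r) * s ^ q := by
    refine one_sub_mul_rpow_pos hq ?_ hs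
    rw [div_lt_one h1]
    linarith [hr.2]
  have h4 : 1 - (1 + s ^ q) * r = (1 - r) * (1 - r / (1 - r) * s ^ q) := by
    field_simp
    ring
  rw [h4, mul_rpow h1.le h3.le, mul_rpow h2.le hr.1.le, mul_rpow two_pos.le hr.1.le,
    rpow_neg h2.le (1 / q - 1 / p)]
  have h5 := (rpow_pos_of_pos h2 (1 / q - 1 / p)).ne'
  field_simp

lemma PhiFun_rpow_div_one_sub {p q r : ℝ} (hq : 0 < q) (hr : r ∈ Ioo (0 : ℝ) (1 / 2)) :
    PhiFun p q ((r / (1 - r)) ^ (1 / q))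
      = ∫ s in (0 : ℝ)..1,
        2 ^ (1 / q - 1 / p) * (1 + s ^ q) ^ (-(1 / q - 1 / p)) * (1 - s ^ q) ^ (-(1 / p)) *
          (((1 + s ^ q) * r) ^ (1 / q - 1 / p) * (1 - (1 + s ^ q) * r) ^ (-(1 / p))) := by
  have h1 : 0 < 1 - r := by linarith [hr.2]
  have h2 : 0 < r / (1 - r) := div_pos hr.1 h1
  have hk : ((r / (1 - r)) ^ (1 / q)) ^ q = r / (1 - r) := by
    rw [one_div, rpow_inv_rpow h2.le hq.ne']
  have h3 : 1 + r / (1 - r) = (1 - r)⁻¹ := by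
    field_simp
    ring
  have h4 : 2 * (r / (1 - r)) / (1 - r)⁻¹ = 2 * r := by field_simp
  rw [PhiFun, Kpq_eq hq (rpow_div_one_sub_mem hq hr), hk, h3, h4, inv_rpow h1.le,
    ← rpow_neg h1.le, ← intervalIntegral.integral_const_mul]
  refine intervalIntegral.integral_congr fun s hs => ?_
  rw [uIcc_of_le zero_le_one] at hs
  exact const_mul_PhiFun_integrand hq hr hs

lemma intervalIntegrable_PhiFun_integrand {p q r : ℝ} (hp : 1 < p) (hq : 1 ≤ q)
    (hr : r ∈ Ioo (0 : ℝ) (1 / 2)) :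
    IntervalIntegrable (fun s : ℝ =>
      2 ^ (1 / q - 1 / p) * (1 + s ^ q) ^ (-(1 / q - 1 / p)) * (1 - s ^ q) ^ (-(1 / p)) *
        (((1 + s ^ q) * r) ^ (1 / q - 1 / p) * (1 - (1 + s ^ q) * r) ^ (-(1 / p))))
      volume 0 1 := by
  have hu : r / (1 - r) < 1 := by
    rw [div_lt_one] <;> linarith [hr.2]
  refine ((intervalIntegrable_mul_rpow (b := 1 / p) hq (by positivity)
    (by rw [div_lt_one] <;> linarith) hu (-(1 / p))).const_mul
      ((1 - r) ^ (-(1 / p)) * (2 * r) ^ (1 / q - 1 / p))).congr fun s hs => ?_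
  rw [uIoc_of_le zero_le_one] at hs
  exact const_mul_PhiFun_integrand (by linarith) hr (Ioc_subset_Icc_self hs)

lemma strictConvexOn_PhiFun_rpow_div_one_sub {p q : ℝ} (hp : 1 < p) (hpq : p < q) :
    StrictConvexOn ℝ (Ioo (0 : ℝ) (1 / 2)) fun r => PhiFun p q ((r / (1 - r)) ^ (1 / q)) := by
  have hq : 0 < q := by linarith
  have hq1 : 1 ≤ q := by linarith
  have hψ := strictConvexOn_rpow_mul_rpow (a := 1 / q - 1 / p) (b := -(1 / p))
    (by linarith [one_div_lt_one_div_of_lt (by linarith : 0 < p) hpq])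
    (neg_lt_zero.2 (by positivity))
  refine ⟨convex_Ioo _ _, fun x hx y hy hxy c d hc hd hcd => ?_⟩
  have hz := convex_Ioo (0 : ℝ) (1 / 2) hx hy hc.le hd.le hcd
  have hX := (intervalIntegrable_PhiFun_integrand hp hq1 hx).const_mul c
  have hY := (intervalIntegrable_PhiFun_integrand hp hq1 hy).const_mul d
  have hZ := intervalIntegrable_PhiFun_integrand hp hq1 hz
  simp only [smul_eq_mul] at hz hZ ⊢
  rw [PhiFun_rpow_div_one_sub hq hx, PhiFun_rpow_div_one_sub hq hy,
    PhiFun_rpow_div_one_sub hq hz, ← intervalIntegral.integral_const_mul,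
    ← intervalIntegral.integral_const_mul, ← intervalIntegral.integral_add hX hY, ← sub_pos,
    ← intervalIntegral.integral_sub (hX.add hY) hZ]
  refine intervalIntegral.intervalIntegral_pos_of_pos_on ((hX.add hY).sub hZ) ?_ zero_lt_one
  intro s hs
  have hs0 : 0 < s ^ q := rpow_pos_of_pos hs.1 q
  have hs1 : s ^ q < 1 := rpow_lt_one hs.1.le hs.2 hq
  have hmem : ∀ r ∈ Ioo (0 : ℝ) (1 / 2), (1 + s ^ q) * r ∈ Ioo (0 : ℝ) 1 := fun r hr =>
    ⟨mul_pos (by linarith) hr.1, by nlinarith [hr.1, hr.2]⟩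
  have h := hψ.2 (hmem x hx) (hmem y hy)
    (fun h => hxy (mul_left_cancel₀ (by linarith) h)) hc hd hcd
  simp only [smul_eq_mul] at h
  rw [show c * ((1 + s ^ q) * x) + d * ((1 + s ^ q) * y) = (1 + s ^ q) * (c * x + d * y) by ring]
    at h
  have hw : 0 < (2 : ℝ) ^ (1 / q - 1 / p) * (1 + s ^ q) ^ (-(1 / q - 1 / p)) *
      (1 - s ^ q) ^ (-(1 / p)) :=
    mul_pos (mul_pos (rpow_pos_of_pos two_pos _) (rpow_pos_of_pos (by linarith) _))
      (rpow_pos_of_pos (by linarith) _)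
  have := mul_lt_mul_of_pos_left h hw
  linarith

lemma isMinOn_PhiFun_of_deriv_eq_zero {p q r : ℝ} (hp : 1 < p) (hpq : p < q)
    (hr : r ∈ Ioo (0 : ℝ) (1 / 2)) (h : deriv (PhiFun p q) ((r / (1 - r)) ^ (1 / q)) = 0) :
    IsMinOn (fun r => PhiFun p q ((r / (1 - r)) ^ (1 / q))) (Ioo (0 : ℝ) (1 / 2)) r := by
  have hq : 0 < q := by linarith
  have h1 : 0 < 1 - r := by linarith [hr.2]
  have hd : DifferentiableAt ℝ (fun r : ℝ => (r / (1 - r)) ^ (1 / q)) r :=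
    (differentiableAt_id.div (differentiableAt_id.const_sub 1) h1.ne').rpow_const
      (Or.inl (div_pos hr.1 h1).ne')
  have hΦ := (differentiableAt_PhiFun hp (hp.trans hpq).le
    (rpow_div_one_sub_mem hq hr)).hasDerivAt
  rw [h] at hΦ
  have hF := HasDerivAt.comp r hΦ hd.hasDerivAt
  rw [zero_mul] at hF
  refine (strictConvexOn_PhiFun_rpow_div_one_sub hp hpq).convexOn.isMinOn_of_rightDeriv_eq_zero
    (by rwa [interior_Ioo]) ?_
  exact hF.hasDerivWithinAt.derivWithin (uniqueDiffWithinAt_Ioi r)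

lemma exists_rpow_div_one_sub_eq {q k : ℝ} (hq : 0 < q) (hk : k ∈ Ioo (0 : ℝ) 1) :
    ∃ r ∈ Ioo (0 : ℝ) (1 / 2), (r / (1 - r)) ^ (1 / q) = k := by
  have h0 : 0 < k ^ q := rpow_pos_of_pos hk.1 q
  have h1 : k ^ q < 1 := rpow_lt_one hk.1.le hk.2 hq
  refine ⟨k ^ q / (1 + k ^ q), ⟨by positivity, ?_⟩, ?_⟩
  · rw [div_lt_div_iff₀ (by positivity) two_pos]
    linarith
  · have : k ^ q / (1 + k ^ q) / (1 - k ^ q / (1 + k ^ q)) = k ^ q := by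
      field_simp
      ring
    rw [this, one_div, rpow_rpow_inv hk.1.le hq.ne']

theorem stmt17 (p q : ℝ) (hp : 1 < p) (hpq : p < q) :
    let ψ := fun t : ℝ => t ^ (1 / q - 1 / p) * (1 - t) ^ (-(1 / p))
    StrictConvexOn ℝ (Ioo 0 1) (fun t => Real.log (ψ t)) ∧
    (∀ t ∈ Ioo (0:ℝ) 1,
      deriv (deriv (fun s => Real.log (ψ s))) t
        = (1 / p - 1 / q) / t ^ 2 + (1 / p) / (1 - t) ^ 2 ∧
      0 < (1 / p - 1 / q) / t ^ 2 + (1 / p) / (1 - t) ^ 2) ∧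
    (p ≤ 2 →
      Tendsto (PhiFun p q) (nhdsWithin 0 (Ioi 0)) atTop ∧
      Tendsto (PhiFun p q) (nhdsWithin 1 (Iio 1)) atTop ∧
      ∃ k₀ ∈ Ioo (0:ℝ) 1, deriv (PhiFun p q) k₀ = 0 ∧
        (∀ k ∈ Ioo (0:ℝ) 1, PhiFun p q k₀ ≤ PhiFun p q k) ∧
        (∀ k ∈ Ioo (0:ℝ) 1, deriv (PhiFun p q) k = 0 → k = k₀)) := by
  intro ψ
  have hp0 : 0 < p := by linarith
  have hq : 0 < q := by linarith
  have ha : 0 < 1 / p - 1 / q := sub_pos.2 (one_div_lt_one_div_of_lt hp0 hpq)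
  have hb : 0 < 1 / p := by positivity
  refine ⟨strictConvexOn_log_rpow_mul_rpow (by linarith) (by linarith), fun t ht => ⟨?_, ?_⟩,
    fun hp2 => ?_⟩
  · rw [deriv_deriv_log_rpow_mul_rpow ht, neg_sub, neg_neg]
  · have h1 : 0 < 1 - t := by linarith [ht.2]
    have h0 := ht.1
    positivity
  have h0 := tendsto_PhiFun_zero hp hpq
  have h1 := tendsto_PhiFun_one hp hp2 hpq
  obtain ⟨k₀, hk₀, hmin⟩ := ContinuousOn.exists_isMinOn_Ioo_of_tendsto_atTop zero_lt_one
    (fun k hk => (differentiableAt_PhiFun hp (hp.trans hpq).le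
      hk).continuousAt.continuousWithinAt) h0 h1
  have hcrit : deriv (PhiFun p q) k₀ = 0 :=
    (hmin.isLocalMin (Ioo_mem_nhds hk₀.1 hk₀.2)).deriv_eq_zero
  refine ⟨h0, h1, k₀, hk₀, hcrit, fun k hk => hmin hk, fun k hk hcrit' => ?_⟩
  obtain ⟨r₀, hr₀, rfl⟩ := exists_rpow_div_one_sub_eq hq hk₀
  obtain ⟨r, hr, rfl⟩ := exists_rpow_div_one_sub_eq hq hk
  rw [(strictConvexOn_PhiFun_rpow_div_one_sub hp hpq).eq_of_isMinOn
    (isMinOn_PhiFun_of_deriv_eq_zero hp hpq hr hcrit')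
    (isMinOn_PhiFun_of_deriv_eq_zero hp hpq hr₀ hcrit) hr hr₀]
end
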